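/- If b = 5·2^n with n ≥ 3, then M_b = 4n + 6 if n ≡ 0 (mod 4), M_b = 3n + 5 if n ≡ 1 (mod 4), M_b = 3n + 5 if n ≡ 2 (mod 4), and M_b = 5n + 6 if n ≡ 3 (mod 4). -/

import Mathlib

/-- The four base-`b` digits of `x` (viewed as a 4-digit string with leading
zeros allowed), sorted in decreasing order. -/
def sortedDigits (b x : ℕ) : List ℕ :=
  List.insertionSort (· ≥ ·) [x % b, x / b % b, x / b ^ 2 % b, x / b ^ 3 % b]

/-- The 4-digit base-`b` Kaprekar function `K_b(x) = D - A`. -/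
def Kap (b x : ℕ) : ℕ :=
  let l := sortedDigits b x
  (l[0]! * b ^ 3 + l[1]! * b ^ 2 + l[2]! * b + l[3]!) -
    (l[3]! * b ^ 3 + l[2]! * b ^ 2 + l[1]! * b + l[0]!)

/-- The difference pair `(a₃ - a₀, a₂ - a₁)` of a 4-digit base-`b` input. -/
def diffPair (b x : ℕ) : ℕ × ℕ :=
  let l := sortedDigits b x
  (l[0]! - l[3]!, l[1]! - l[2]!)

/-- `S_b`: the set of 4-digit base-`b` inputs whose sequence of Kaprekar
iterates is eventually constant and nonzero. -/
def KapSet (b : ℕ) : Set ℕ :=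
  {x | x < b ^ 4 ∧
    ∃ t, (∀ s, t ≤ s → (Kap b)^[s] x = (Kap b)^[t] x) ∧ (Kap b)^[t] x ≠ 0}

/-- Arrange the two coordinates of a pair in decreasing order. -/
def sort2 (p : ℕ × ℕ) : ℕ × ℕ := (max p.1 p.2, min p.1 p.2)

/-- A base-`b` difference pair: `b - 1 ≥ d ≥ d' ≥ 0`. -/
def IsDiffPair (b : ℕ) (p : ℕ × ℕ) : Prop := p.2 ≤ p.1 ∧ p.1 ≤ b - 1

/-- The Kaprekar map on base-`b` difference pairs. -/
def Kpair (b : ℕ) (p : ℕ × ℕ) : ℕ × ℕ :=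
  if p.1 = 0 ∧ p.2 = 0 then (0, 0)
  else if p.2 = 0 then
    -- type (c)
    sort2 (p.1 - 1, b - p.1)
  else if p.1 = p.2 ∨ p.1 + p.2 = b then
    -- type (b)
    sort2 ((2 * (p.1 : ℤ) - ((b : ℤ) - 1)).natAbs,
           (2 * (p.1 : ℤ) - ((b : ℤ) + 1)).natAbs)
  else
    -- type (a)
    sort2 ((2 * (p.1 : ℤ) - (b : ℤ)).natAbs, (2 * (p.2 : ℤ) - (b : ℤ)).natAbs)

/-- The coordinate map `d ↦ |2d - b|` of a type (a) step. -/
def tent (b d : ℕ) : ℕ := (2 * (d : ℤ) - b).natAbs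

theorem tent_le {b d : ℕ} (h : d ≤ b) : tent b d ≤ b := by
  unfold tent; omega

theorem tent_iterate_le {b d : ℕ} (h : d ≤ b) (k : ℕ) : (tent b)^[k] d ≤ b := by
  induction k with
  | zero => exact h
  | succ k ih => rw [Function.iterate_succ_apply']; exact tent_le ih

theorem tent_iterate_self (b k : ℕ) : (tent b)^[k] b = b :=
  Function.iterate_fixed (by unfold tent; omega) k

theorem tent_iterate_spec (b d k : ℕ) :
    (2 * b : ℤ) ∣ ((tent b)^[k + 1] d : ℕ) - b - 2 ^ (k + 1) * d ∨
      (2 * b : ℤ) ∣ ((tent b)^[k + 1] d : ℕ) - b + 2 ^ (k + 1) * d := by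
  induction k with
  | zero =>
    have h : ((tent b d : ℕ) : ℤ) = 2 * d - b ∨ ((tent b d : ℕ) : ℤ) = -(2 * d - b) := by
      unfold tent; omega
    rcases h with h | h
    · left; refine ⟨-1, ?_⟩; simp [h]; ring
    · right; refine ⟨0, ?_⟩; simp [h]
  | succ k ih =>
    rw [Function.iterate_succ_apply']
    set v := (tent b)^[k + 1] d
    have h : ((tent b v : ℕ) : ℤ) = 2 * v - b ∨ ((tent b v : ℕ) : ℤ) = -(2 * v - b) := by
      unfold tent; omega
    rcases h with h | h <;> rcases ih with ⟨q, hq⟩ | ⟨q, hq⟩ <;> rw [h]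
    · left; refine ⟨2 * q, ?_⟩; linear_combination 2 * hq
    · right; refine ⟨2 * q, ?_⟩; linear_combination 2 * hq
    · right; refine ⟨-2 * q - 1, ?_⟩; linear_combination -2 * hq
    · left; refine ⟨-2 * q - 1, ?_⟩; linear_combination -2 * hq

/-- A point of `[0, b]` is determined by its class modulo `2b` up to sign. -/
theorem eq_of_dvd_sub_or_add {b v w : ℕ} (hv : v ≤ b) (hw : w ≤ b)
    (h : (2 * b : ℤ) ∣ v - w ∨ (2 * b : ℤ) ∣ v + w) : v = w := by
  rcases Nat.eq_zero_or_pos b with rfl | hb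
  · omega
  rcases h with ⟨q, hq⟩ | ⟨q, hq⟩
  · have h1 : q < 1 := by nlinarith
    have h2 : -1 < q := by nlinarith
    obtain rfl : q = 0 := by omega
    omega
  · have h1 : q < 2 := by nlinarith
    have h2 : -1 < q := by nlinarith
    interval_cases q <;> omega

theorem tent_iterate_eq_of_dvd {b d k v : ℕ} (hk : 1 ≤ k) (hd : d ≤ b) (hv : v ≤ b)
    (h : (2 * b : ℤ) ∣ v - b - 2 ^ k * d ∨ (2 * b : ℤ) ∣ v - b + 2 ^ k * d) :
    (tent b)^[k] d = v := by
  obtain ⟨k, rfl⟩ := Nat.exists_eq_add_of_le' hk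
  have hs := tent_iterate_spec b d k
  refine eq_of_dvd_sub_or_add (tent_iterate_le hd _) hv ?_
  rcases hs with ⟨p, hp⟩ | ⟨p, hp⟩ <;> rcases h with ⟨q, hq⟩ | ⟨q, hq⟩
  · left; exact ⟨p - q, by linear_combination hp - hq⟩
  · right; exact ⟨p + q + 1, by linear_combination hp + hq⟩
  · right; exact ⟨p + q + 1, by linear_combination hp + hq⟩
  · left; exact ⟨p - q, by linear_combination hp - hq⟩

theorem tent_iterate_eq_iff {b x y k : ℕ} (hk : 1 ≤ k) (hx : x ≤ b) (hy : y ≤ b) :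
    (tent b)^[k] x = (tent b)^[k] y ↔
      (2 * b : ℤ) ∣ 2 ^ k * (x - y) ∨ (2 * b : ℤ) ∣ 2 ^ k * (x + y) := by
  obtain ⟨k, rfl⟩ := Nat.exists_eq_add_of_le' hk
  have hs := tent_iterate_spec b x k
  have ht := tent_iterate_spec b y k
  constructor
  · intro h
    rw [h] at hs
    rcases hs with ⟨p, hp⟩ | ⟨p, hp⟩ <;> rcases ht with ⟨q, hq⟩ | ⟨q, hq⟩
    · left; exact ⟨q - p, by linear_combination hq - hp⟩
    · right; exact ⟨q - p, by linear_combination hq - hp⟩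
    · right; exact ⟨p - q, by linear_combination hp - hq⟩
    · left; exact ⟨p - q, by linear_combination hp - hq⟩
  · intro h
    refine tent_iterate_eq_of_dvd hk hx (tent_iterate_le hy _) ?_
    rcases ht with ⟨p, hp⟩ | ⟨p, hp⟩ <;> rcases h with ⟨q, hq⟩ | ⟨q, hq⟩
    · left; exact ⟨p - q, by linear_combination hp - hq⟩
    · right; exact ⟨p + q, by linear_combination hp + hq⟩
    · right; exact ⟨p + q, by linear_combination hp + hq⟩
    · left; exact ⟨p - q, by linear_combination hp - hq⟩

theorem tent_iterate_eq_base_iff {b x k : ℕ} (hk : 1 ≤ k) (hx : x ≤ b) :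
    (tent b)^[k] x = b ↔ (2 * b : ℤ) ∣ 2 ^ k * x := by
  constructor
  · intro h
    obtain ⟨k, rfl⟩ := Nat.exists_eq_add_of_le' hk
    have hs := tent_iterate_spec b x k
    rw [h] at hs
    rcases hs with ⟨q, hq⟩ | ⟨q, hq⟩
    · exact ⟨-q, by linear_combination -hq⟩
    · exact ⟨q, by linear_combination hq⟩
  · rintro ⟨q, hq⟩
    exact tent_iterate_eq_of_dvd hk hx le_rfl (Or.inr ⟨q, by linear_combination hq⟩)

theorem sort2_comm (x y : ℕ) : sort2 (x, y) = sort2 (y, x) := by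
  simp [sort2, max_comm, min_comm]

theorem Kpair_sort2_of_generic {b x y : ℕ} (hx : 0 < x) (hy : 0 < y) (hne : x ≠ y)
    (hsum : x + y ≠ b) : Kpair b (sort2 (x, y)) = sort2 (tent b x, tent b y) := by
  rcases le_total x y with h | h <;>
    simp only [Kpair, sort2, tent, max_eq_right h, min_eq_left h, max_eq_left h, min_eq_right h]
  · rw [if_neg (by omega), if_neg (by omega), if_neg (by omega)]
    simp [max_comm, min_comm]
  · rw [if_neg (by omega), if_neg (by omega), if_neg (by omega)]

theorem Kpair_sort2_of_balanced {b x y : ℕ} (hx : 0 < x) (hy : 0 < y)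
    (h : x = y ∨ x + y = b) : Kpair b (sort2 (x, y)) =
      sort2 ((2 * (x : ℤ) - b + 1).natAbs, (2 * (x : ℤ) - b - 1).natAbs) := by
  rcases le_total x y with h' | h' <;>
    simp only [Kpair, sort2, max_eq_right h', min_eq_left h', max_eq_left h', min_eq_right h']
  · rw [if_neg (by omega), if_neg (by omega), if_pos (by omega)]
    ext <;> simp only <;> omega
  · rw [if_neg (by omega), if_neg (by omega), if_pos (by omega)]
    ext <;> simp only <;> omega

theorem Kpair_sort2_zero {b x : ℕ} (hx : 0 < x) :
    Kpair b (sort2 (x, 0)) = sort2 (x - 1, b - x) := by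
  simp only [Kpair, sort2, Nat.zero_le, max_eq_left, min_eq_right]
  rw [if_neg (by omega), if_pos trivial]

/-- While no coincidence and no zero occurs, the pair map acts coordinatewise. -/
theorem Kpair_iterate_of_tent_ne {b x y : ℕ} (m : ℕ)
    (hne : (tent b)^[m] x ≠ (tent b)^[m] y) (hxb : (tent b)^[m] x ≠ b)
    (hyb : (tent b)^[m] y ≠ b) :
    (Kpair b)^[m] (sort2 (x, y)) = sort2 ((tent b)^[m] x, (tent b)^[m] y) := by
  induction m generalizing x y with
  | zero => rfl
  | succ m ih =>
    simp only [Function.iterate_succ_apply] at *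
    have h0 : tent b 0 = b := by simp [tent]
    rw [Kpair_sort2_of_generic, ih hne hxb hyb]
    · rcases Nat.eq_zero_or_pos x with rfl | h
      · rw [h0, tent_iterate_self] at hxb; exact absurd rfl hxb
      · exact h
    · rcases Nat.eq_zero_or_pos y with rfl | h
      · rw [h0, tent_iterate_self] at hyb; exact absurd rfl hyb
      · exact h
    · rintro rfl; exact hne rfl
    · intro h
      apply hne
      congr 1
      unfold tent; omega

/-- The value of the Kaprekar function in terms of the difference pair. -/
def pairValue (b : ℕ) (p : ℕ × ℕ) : ℕ := p.1 * (b ^ 3 - 1) + p.2 * (b ^ 2 - b)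

theorem insertionSort_four (p q r s : ℕ) : ∃ w x y z,
    List.insertionSort (· ≥ ·) [p, q, r, s] = [w, x, y, z] ∧ z ≤ y ∧ y ≤ x ∧ x ≤ w ∧
      (w = p ∨ w = q ∨ w = r ∨ w = s) := by
  simp only [List.insertionSort_cons, List.insertionSort_nil, List.orderedInsert]
  split_ifs <;> simp only [List.orderedInsert] <;> split_ifs <;>
    simp only [List.orderedInsert] <;> split_ifs <;>
    exact ⟨_, _, _, _, rfl, by omega, by omega, by omega, by omega⟩

theorem exists_sortedDigits_eq {b : ℕ} (hb : 0 < b) (x : ℕ) : ∃ p q r s,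
    sortedDigits b x = [p, q, r, s] ∧ s ≤ r ∧ r ≤ q ∧ q ≤ p ∧ p < b := by
  obtain ⟨p, q, r, s, h, h1, h2, h3, h4⟩ :=
    insertionSort_four (x % b) (x / b % b) (x / b ^ 2 % b) (x / b ^ 3 % b)
  refine ⟨p, q, r, s, h, h1, h2, h3, ?_⟩
  rcases h4 with rfl | rfl | rfl | rfl <;> exact Nat.mod_lt _ hb

theorem isDiffPair_diffPair {b : ℕ} (hb : 0 < b) (x : ℕ) : IsDiffPair b (diffPair b x) := by
  obtain ⟨p, q, r, s, h, h1, h2, h3, h4⟩ := exists_sortedDigits_eq hb x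
  simp only [IsDiffPair, diffPair, h]
  simp
  omega

theorem Kap_eq_pairValue {b : ℕ} (hb : 0 < b) (x : ℕ) :
    Kap b x = pairValue b (diffPair b x) := by
  obtain ⟨p, q, r, s, h, h1, h2, h3, h4⟩ := exists_sortedDigits_eq hb x
  simp only [Kap, diffPair, pairValue, h]
  simp
  obtain ⟨u, rfl⟩ := Nat.exists_eq_add_of_le h1
  obtain ⟨v, rfl⟩ := Nat.exists_eq_add_of_le h2
  obtain ⟨w, rfl⟩ := Nat.exists_eq_add_of_le h3
  have e1 : s + u + v + w - s = u + v + w := by omega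
  have e2 : s + u + v - (s + u) = v := by omega
  rw [e1, e2]
  obtain ⟨c, hc⟩ : ∃ c, b ^ 3 = c + 1 := ⟨b ^ 3 - 1, by have := Nat.pow_pos (n := 3) hb; omega⟩
  obtain ⟨d, hd⟩ : ∃ d, b ^ 2 = d + b := ⟨b ^ 2 - b, by
    nlinarith [Nat.sub_add_cancel (show b ≤ b ^ 2 by nlinarith)]⟩
  rw [hc, hd, Nat.add_sub_cancel, Nat.add_sub_cancel, Nat.sub_eq_iff_eq_add]
  · ring
  · ring_nf
    nlinarith [Nat.zero_le (u * c), Nat.zero_le (v * c), Nat.zero_le (w * c), Nat.zero_le (v * d)]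

theorem sortedDigits_of_digits {b p q r s : ℕ} (hp : p < b) (hq : q < b) (hr : r < b)
    (hs : s < b) : sortedDigits b (p * b ^ 3 + q * b ^ 2 + r * b + s) =
      List.insertionSort (· ≥ ·) [s, r, q, p] := by
  have hb : 0 < b := by omega
  have d0 : p * b ^ 3 + q * b ^ 2 + r * b + s = s + b * (r + b * (q + b * p)) := by ring
  have e1 : (s + b * (r + b * (q + b * p))) / b = r + b * (q + b * p) := by
    rw [Nat.add_mul_div_left _ _ hb, Nat.div_eq_of_lt hs, zero_add]
  have e2 : (r + b * (q + b * p)) / b = q + b * p := by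
    rw [Nat.add_mul_div_left _ _ hb, Nat.div_eq_of_lt hr, zero_add]
  have e3 : (q + b * p) / b = p := by
    rw [Nat.add_mul_div_left _ _ hb, Nat.div_eq_of_lt hq, zero_add]
  have e4 : (s + b * (r + b * (q + b * p))) / b ^ 2 = q + b * p := by
    rw [pow_two, ← Nat.div_div_eq_div_mul, e1, e2]
  have e5 : (s + b * (r + b * (q + b * p))) / b ^ 3 = p := by
    rw [pow_succ, ← Nat.div_div_eq_div_mul, e4, e3]
  rw [sortedDigits, d0, e1, e4, e5]
  simp [Nat.add_mul_mod_self_left, Nat.mod_eq_of_lt, hp, hq, hr, hs]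

theorem diffPair_insertionSort {b p q r s : ℕ} (hp : p < b) (hq : q < b) (hr : r < b)
    (hs : s < b) {x : ℕ} (hx : x = p * b ^ 3 + q * b ^ 2 + r * b + s) {w y : ℕ}
    (h : let l := List.insertionSort (· ≥ ·) [s, r, q, p]
      (l[0]! - l[3]!, l[1]! - l[2]!) = (w, y)) : diffPair b x = (w, y) := by
  rw [diffPair, hx, sortedDigits_of_digits hp hq hr hs]
  exact h

set_option maxHeartbeats 1000000 in
theorem diffPair_pairValue {b : ℕ} (hb : 2 ≤ b) {p : ℕ × ℕ} (hp : IsDiffPair b p) :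
    diffPair b (pairValue b p) = Kpair b p := by
  obtain ⟨x, y⟩ := p
  obtain ⟨hyx, hxb⟩ := hp
  simp only at hyx hxb
  obtain ⟨B, rfl⟩ : ∃ B, b = B + 2 := ⟨b - 2, by omega⟩
  have hbb : B + 2 ≤ (B + 2) ^ 2 := by nlinarith
  have hb3 : 1 ≤ (B + 2) ^ 3 := Nat.one_le_pow _ _ (by omega)
  rcases Nat.eq_zero_or_pos x with rfl | hx
  · obtain rfl : y = 0 := by omega
    refine diffPair_insertionSort (p := 0) (q := 0) (r := 0) (s := 0) (by omega) (by omega)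
      (by omega) (by omega) (by simp [pairValue]) (by simp)
  rcases Nat.eq_zero_or_pos y with rfl | hy
  · obtain ⟨x, rfl⟩ := Nat.exists_eq_add_of_le' hx
    refine diffPair_insertionSort (p := x) (q := B + 1) (r := B + 1) (s := B + 1 - x)
      (by omega) (by omega) (by omega) (by omega) ?_ ?_
    · obtain ⟨z, rfl⟩ := Nat.exists_eq_add_of_le (show x ≤ B by omega)
      rw [pairValue, show x + z + 1 - x = z + 1 by omega]
      zify [hbb, hb3]
      ring
    · clear hbb hb3
      simp only [List.insertionSort_cons, List.insertionSort_nil, List.orderedInsert]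
      split_ifs <;> simp only [List.orderedInsert] <;> split_ifs <;>
        simp only [List.orderedInsert] <;> split_ifs <;>
          first | (exfalso; omega) | (simp <;> omega)
  · obtain ⟨y, rfl⟩ := Nat.exists_eq_add_of_le' hy
    simp only [Kpair, sort2]
    rw [if_neg (by omega), if_neg (by omega)]
    split_ifs with h
    all_goals
      refine diffPair_insertionSort (p := x) (q := y) (r := B - y) (s := B + 2 - x)
        (by omega) (by omega) (by omega) (by omega) ?_ ?_
      · obtain ⟨z, hz⟩ := Nat.exists_eq_add_of_le (show y ≤ B by omega)
        obtain ⟨t, ht⟩ := Nat.exists_eq_add_of_le (show x ≤ B + 2 by omega)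
        rw [pairValue, ht, Nat.add_sub_cancel_left, show B - y = z by omega, ← ht]
        zify [hbb, hb3] at *
        linear_combination (B + 2 : ℤ) * hz + ht
      · clear hbb hb3
        simp only [List.insertionSort_cons, List.insertionSort_nil, List.orderedInsert]
        split_ifs <;> simp only [List.orderedInsert] <;> split_ifs <;>
          simp only [List.orderedInsert] <;> split_ifs <;>
          first | (exfalso; omega) | (simp <;> omega)

theorem diffPair_Kap {b : ℕ} (hb : 2 ≤ b) (x : ℕ) :
    diffPair b (Kap b x) = Kpair b (diffPair b x) := by
  rw [Kap_eq_pairValue (by omega), diffPair_pairValue hb (isDiffPair_diffPair (by omega) x)]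

theorem diffPair_Kap_iterate {b : ℕ} (hb : 2 ≤ b) (x k : ℕ) :
    diffPair b ((Kap b)^[k] x) = (Kpair b)^[k] (diffPair b x) :=
  Function.Semiconj.iterate_right (f := diffPair b) (diffPair_Kap hb) k x

theorem Kap_iterate_succ {b : ℕ} (hb : 2 ≤ b) (x k : ℕ) :
    (Kap b)^[k + 1] x = pairValue b ((Kpair b)^[k] (diffPair b x)) := by
  rw [Function.iterate_succ_apply', Kap_eq_pairValue (by omega), diffPair_Kap_iterate hb]

theorem pairValue_injOn {b : ℕ} {p q : ℕ × ℕ} (hp : IsDiffPair b p)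
    (hq : IsDiffPair b q) (hb : 2 ≤ b) (h : pairValue b p = pairValue b q) : p = q := by
  obtain ⟨x, y⟩ := p
  obtain ⟨z, w⟩ := q
  obtain ⟨h1, h2⟩ := hp
  obtain ⟨h3, h4⟩ := hq
  simp only [pairValue] at *
  have hbb : b ≤ b ^ 2 := by nlinarith
  have hb3 : 1 ≤ b ^ 3 := Nat.one_le_pow _ _ (by omega)
  have h2' : x + 1 ≤ b := by omega
  have h4' : z + 1 ≤ b := by omega
  have key : (x : ℤ) = z := by
    zify [hbb, hb3] at *
    have e : ((x : ℤ) - z) * ((b : ℤ) ^ 2 + b + 1) = (w - y) * b := by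
      have hne : ((b : ℤ) - 1) ≠ 0 := by linarith
      apply mul_left_cancel₀ hne
      linear_combination h
    have hlt : ((w : ℤ) - y) * b < (b : ℤ) ^ 2 + b + 1 := by nlinarith
    have hgt : -((b : ℤ) ^ 2 + b + 1) < ((w : ℤ) - y) * b := by nlinarith
    have hpos : (0 : ℤ) < (b : ℤ) ^ 2 + b + 1 := by positivity
    rw [← e] at hlt hgt
    have h5 : (x : ℤ) - z < 1 := by nlinarith
    have h6 : -1 < (x : ℤ) - z := by nlinarith
    omega
  obtain rfl : x = z := by exact_mod_cast key
  have h7 : y * (b ^ 2 - b) = w * (b ^ 2 - b) := by omega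
  have h8 : 0 < b ^ 2 - b := by
    have : b < b ^ 2 := by nlinarith
    omega
  rw [Nat.eq_of_mul_eq_mul_right h8 h7]

theorem diffPair_digits_zero_zero {b : ℕ} {p : ℕ × ℕ} (hp : IsDiffPair b p) (hb : 0 < b) :
    diffPair b (p.1 * b ^ 3 + p.2 * b ^ 2) = p := by
  obtain ⟨x, y⟩ := p
  obtain ⟨h1, h2⟩ := hp
  simp only at h1 h2
  refine diffPair_insertionSort (p := x) (q := y) (r := 0) (s := 0) (by omega) (by omega)
    (by omega) (by omega) (by simp) ?_
  simp only [List.insertionSort_cons, List.insertionSort_nil, List.orderedInsert]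
  split_ifs <;> simp only [List.orderedInsert] <;> split_ifs <;>
    simp only [List.orderedInsert] <;> split_ifs <;>
          first | (exfalso; omega) | (simp <;> omega)

section Dynamics

variable {n : ℕ}

theorem not_dvd_of_not_five_dvd {z : ℤ} (hz : ¬ 5 ∣ z) (k : ℕ) :
    ¬ (2 * ((5 * 2 ^ n : ℕ) : ℤ)) ∣ 2 ^ k * z := by
  intro h
  have h5 : (5 : ℤ) ∣ 2 ^ k * z := Dvd.dvd.trans ⟨2 * 2 ^ n, by push_cast; ring⟩ h
  have hp : Prime (5 : ℤ) := by norm_num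
  rcases hp.dvd_or_dvd h5 with h | h
  · have := hp.dvd_of_dvd_pow h
    norm_num at this
  · exact hz h

theorem not_dvd_of_odd {z : ℤ} (hz : Odd z) {k : ℕ} (hk : k ≤ n) :
    ¬ (2 * ((5 * 2 ^ n : ℕ) : ℤ)) ∣ 2 ^ k * z := by
  rintro ⟨q, hq⟩
  obtain ⟨m, rfl⟩ := Nat.exists_eq_add_of_le hk
  have h2 : (2 : ℤ) ^ k ≠ 0 := by positivity
  have h : z = 2 * (5 * 2 ^ m * q) := by
    apply mul_left_cancel₀ h2
    push_cast at hq
    rw [hq]; ring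
  rw [← Int.not_even_iff_odd] at hz
  exact hz (h ▸ even_two_mul _)

theorem Kpair_iterate_of_not_dvd {b x y : ℕ} (m : ℕ) (hx : x < b) (hy : y < b)
    (hxm : ¬ (2 * b : ℤ) ∣ 2 ^ m * x) (hym : ¬ (2 * b : ℤ) ∣ 2 ^ m * y)
    (hs : ¬ (2 * b : ℤ) ∣ 2 ^ m * (x - y)) (ha : ¬ (2 * b : ℤ) ∣ 2 ^ m * (x + y)) :
    (Kpair b)^[m] (sort2 (x, y)) = sort2 ((tent b)^[m] x, (tent b)^[m] y) := by
  rcases Nat.eq_zero_or_pos m with rfl | hm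
  · rfl
  apply Kpair_iterate_of_tent_ne
  · rw [Ne, tent_iterate_eq_iff hm hx.le hy.le]; tauto
  · rwa [Ne, tent_iterate_eq_base_iff hm hx.le]
  · rwa [Ne, tent_iterate_eq_base_iff hm hy.le]

theorem tent_iterate_balanced {b x y : ℕ} (m : ℕ) (hx : x ≤ b) (hy : y ≤ b)
    (h : (2 * b : ℤ) ∣ 2 ^ (m + 1) * (x - y) ∨ (2 * b : ℤ) ∣ 2 ^ (m + 1) * (x + y)) :
    (tent b)^[m] x = (tent b)^[m] y ∨ (tent b)^[m] x + (tent b)^[m] y = b := by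
  have h' := (tent_iterate_eq_iff (by omega) hx hy).2 h
  rw [Function.iterate_succ_apply', Function.iterate_succ_apply'] at h'
  unfold tent at h' ⊢
  omega

theorem tent_mod_five (x : ℕ) :
    ((x % 5 = 1 ∨ x % 5 = 4) → (tent (5 * 2 ^ n) x % 5 = 2 ∨ tent (5 * 2 ^ n) x % 5 = 3)) ∧
    ((x % 5 = 2 ∨ x % 5 = 3) → (tent (5 * 2 ^ n) x % 5 = 1 ∨ tent (5 * 2 ^ n) x % 5 = 4)) := by
  unfold tent
  push_cast
  generalize (2 : ℤ) ^ n = N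
  omega

theorem tent_iterate_mod_five_of_even {m : ℕ} (hm : Even m) (x : ℕ) :
    ((x % 5 = 1 ∨ x % 5 = 4) →
      ((tent (5 * 2 ^ n))^[m] x % 5 = 1 ∨ (tent (5 * 2 ^ n))^[m] x % 5 = 4)) ∧
    ((x % 5 = 2 ∨ x % 5 = 3) →
      ((tent (5 * 2 ^ n))^[m] x % 5 = 2 ∨ (tent (5 * 2 ^ n))^[m] x % 5 = 3)) := by
  obtain ⟨k, rfl⟩ := hm
  induction k with
  | zero => exact ⟨id, id⟩
  | succ k ih =>
    rw [show k + 1 + (k + 1) = k + k + 1 + 1 by omega, Function.iterate_succ_apply',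
      Function.iterate_succ_apply']
    have h1 := tent_mod_five (n := n) ((tent (5 * 2 ^ n))^[k + k] x)
    have h2 := tent_mod_five (n := n) (tent (5 * 2 ^ n) ((tent (5 * 2 ^ n))^[k + k] x))
    exact ⟨fun h => h2.2 (h1.1 (ih.1 h)), fun h => h2.1 (h1.2 (ih.2 h))⟩

theorem tent_iterate_mod_five_of_odd {m : ℕ} (hm : Odd m) (x : ℕ) :
    ((x % 5 = 1 ∨ x % 5 = 4) →
      ((tent (5 * 2 ^ n))^[m] x % 5 = 2 ∨ (tent (5 * 2 ^ n))^[m] x % 5 = 3)) ∧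
    ((x % 5 = 2 ∨ x % 5 = 3) →
      ((tent (5 * 2 ^ n))^[m] x % 5 = 1 ∨ (tent (5 * 2 ^ n))^[m] x % 5 = 4)) := by
  obtain ⟨k, rfl⟩ := hm
  have e : (tent (5 * 2 ^ n))^[2 * k + 1] x = tent (5 * 2 ^ n) ((tent (5 * 2 ^ n))^[2 * k] x) :=
    Function.iterate_succ_apply' _ _ _
  rw [e]
  have h1 := tent_iterate_mod_five_of_even (n := n) (even_two_mul k) x
  have h2 := tent_mod_five (n := n) ((tent (5 * 2 ^ n))^[2 * k] x)
  exact ⟨fun h => h2.1 (h1.1 h), fun h => h2.2 (h1.2 h)⟩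

theorem tent_iterate_mod_five_ne_zero (m : ℕ) {x : ℕ} (hx : x % 5 ≠ 0) :
    (tent (5 * 2 ^ n))^[m] x % 5 ≠ 0 := by
  rcases Nat.even_or_odd m with hm | hm
  · have := tent_iterate_mod_five_of_even (n := n) hm x; omega
  · have := tent_iterate_mod_five_of_odd (n := n) hm x; omega

theorem tent_iterate_five_mul_odd {o i m : ℕ} (ho : Odd o) (him : i + m < n) :
    ∃ o', Odd o' ∧ (tent (5 * 2 ^ n))^[m] (5 * 2 ^ i * o) = 5 * 2 ^ (i + m) * o' := by
  induction m with
  | zero => exact ⟨o, ho, rfl⟩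
  | succ m ih =>
    obtain ⟨o', ho', h⟩ := ih (by omega)
    refine ⟨((o' : ℤ) - 2 ^ (n - (i + m + 1))).natAbs, ?_, ?_⟩
    · rw [Int.natAbs_odd]
      refine Odd.sub_even (by exact_mod_cast ho') ?_
      exact (Int.even_pow' (by omega)).2 even_two
    · rw [Function.iterate_succ_apply', h, tent, ← add_assoc]
      have e : 2 * ((5 * 2 ^ (i + m) * o' : ℕ) : ℤ) - ((5 * 2 ^ n : ℕ) : ℤ) =
          ((5 * 2 ^ (i + m + 1) : ℕ) : ℤ) * ((o' : ℤ) - 2 ^ (n - (i + m + 1))) := by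
        have e1 : (2 : ℤ) ^ n = 2 ^ (i + m + 1) * 2 ^ (n - (i + m + 1)) := by
          rw [← pow_add]; congr 1; omega
        push_cast
        rw [e1]; ring
      rw [e, Int.natAbs_mul, Int.natAbs_natCast]

theorem tent_iterate_eq_zero {o i j : ℕ} (ho : Odd o) (hij : i + j = n) (hj : 1 ≤ j)
    (hlt : 5 * 2 ^ i * o ≤ 5 * 2 ^ n) : (tent (5 * 2 ^ n))^[j] (5 * 2 ^ i * o) = 0 := by
  refine tent_iterate_eq_of_dvd hj hlt (Nat.zero_le _) (Or.inr ?_)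
  obtain ⟨c, rfl⟩ := ho
  refine ⟨c, ?_⟩
  push_cast
  rw [← hij, pow_add]; ring

theorem tent_iterate_succ_eq_or {x : ℕ} (hx : x < 5 * 2 ^ n) (h5 : x % 5 ≠ 0) :
    (tent (5 * 2 ^ n))^[n + 1] x = 2 ^ n ∨ (tent (5 * 2 ^ n))^[n + 1] x = 3 * 2 ^ n := by
  have hle := tent_iterate_le hx.le (n + 1)
  have hs := tent_iterate_spec (5 * 2 ^ n) x n
  have hN : 0 < 2 ^ n := by positivity
  generalize (tent (5 * 2 ^ n))^[n + 1] x = v at *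
  have : ∃ t : ℤ, (v : ℤ) = 2 ^ n * t ∧ t % 2 = 1 ∧ t % 5 ≠ 0 := by
    rcases hs with ⟨q, hq⟩ | ⟨q, hq⟩
    · refine ⟨5 + 2 * x + 10 * q, ?_, by omega, by omega⟩
      push_cast at hq; linear_combination hq
    · refine ⟨5 - 2 * x + 10 * q, ?_, by omega, by omega⟩
      push_cast at hq; linear_combination hq
  obtain ⟨t, ht, h2, h5⟩ := this
  zify at *
  have h6 : t < 6 := by nlinarith
  have h0 : -1 < t := by nlinarith
  interval_cases t <;> omega

theorem tent_iterate_ne_of_odd {x : ℕ} (hn : 1 ≤ n) (hx : Odd x) :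
    (tent (5 * 2 ^ n))^[n] x ≠ 2 ^ n ∧ (tent (5 * 2 ^ n))^[n] x ≠ 3 * 2 ^ n := by
  obtain ⟨k, rfl⟩ := Nat.exists_eq_add_of_le' hn
  have hs := tent_iterate_spec (5 * 2 ^ (k + 1)) x k
  obtain ⟨c, rfl⟩ := hx
  generalize (tent (5 * 2 ^ (k + 1)))^[k + 1] (2 * c + 1) = v at *
  have : ∃ t : ℤ, (v : ℤ) = 2 ^ (k + 1) * t ∧ t % 2 = 0 := by
    rcases hs with ⟨q, hq⟩ | ⟨q, hq⟩
    · refine ⟨5 + (2 * c + 1) + 10 * q, ?_, by omega⟩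
      push_cast at hq; linear_combination hq
    · refine ⟨5 - (2 * c + 1) + 10 * q, ?_, by omega⟩
      push_cast at hq; linear_combination hq
  obtain ⟨t, ht, h2⟩ := this
  have hN : (2 : ℤ) ^ (k + 1) ≠ 0 := by positivity
  constructor
  · intro h
    have h1 : (2 : ℤ) ^ (k + 1) * t = 2 ^ (k + 1) * 1 := by rw [← ht, h]; push_cast; ring
    have := mul_left_cancel₀ hN h1
    omega
  · intro h
    have h1 : (2 : ℤ) ^ (k + 1) * t = 2 ^ (k + 1) * 3 := by rw [← ht, h]; push_cast; ring
    have := mul_left_cancel₀ hN h1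
    omega

theorem tent_iterate_eq_two_pow_succ {x : ℕ} (hn : 1 ≤ n) (hlt : x < 5 * 2 ^ n) (hx : Odd x)
    (h5 : x % 5 = 2 ∨ x % 5 = 3) : (tent (5 * 2 ^ n))^[n] x = 2 ^ (n + 1) := by
  have hN : 0 < 2 ^ n := by positivity
  refine tent_iterate_eq_of_dvd hn hlt.le (by rw [pow_succ]; omega) ?_
  obtain ⟨c, rfl⟩ := hx
  rcases h5 with h5 | h5
  · left
    obtain ⟨q, hq⟩ : (10 : ℤ) ∣ -3 - (2 * c + 1) := by omega
    refine ⟨q, ?_⟩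
    push_cast
    rw [pow_succ]
    linear_combination (2 : ℤ) ^ n * hq
  · right
    obtain ⟨q, hq⟩ : (10 : ℤ) ∣ -3 + (2 * c + 1) := by omega
    refine ⟨q, ?_⟩
    push_cast
    rw [pow_succ]
    linear_combination (2 : ℤ) ^ n * hq

/-- Pairs whose entries are, up to order and sign, `±1` and `±2` modulo `5`. -/
theorem Kpair_iterate_eq_fixed {x y : ℕ} (hx : x < 5 * 2 ^ n) (hy : y < 5 * 2 ^ n)
    (h : ((x % 5 = 1 ∨ x % 5 = 4) ∧ (y % 5 = 2 ∨ y % 5 = 3)) ∨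
      ((x % 5 = 2 ∨ x % 5 = 3) ∧ (y % 5 = 1 ∨ y % 5 = 4))) :
    (Kpair (5 * 2 ^ n))^[n + 1] (sort2 (x, y)) = (3 * 2 ^ n, 2 ^ n) := by
  have hs : ¬ (5 : ℤ) ∣ x - y := by omega
  have ha : ¬ (5 : ℤ) ∣ x + y := by omega
  rw [Kpair_iterate_of_not_dvd (n + 1) hx hy (not_dvd_of_not_five_dvd (by omega) _)
    (not_dvd_of_not_five_dvd (by omega) _) (not_dvd_of_not_five_dvd hs _)
    (not_dvd_of_not_five_dvd ha _)]
  have hne : (tent (5 * 2 ^ n))^[n + 1] x ≠ (tent (5 * 2 ^ n))^[n + 1] y := by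
    rw [Ne, tent_iterate_eq_iff (by omega) hx.le hy.le, not_or]
    exact ⟨not_dvd_of_not_five_dvd hs _, not_dvd_of_not_five_dvd ha _⟩
  rcases tent_iterate_succ_eq_or hx (by omega) with h1 | h1 <;>
    rcases tent_iterate_succ_eq_or hy (by omega) with h2 | h2 <;>
    rw [h1, h2] at hne ⊢ <;> simp [sort2] at hne ⊢

theorem Kpair_iterate_ne_fixed {x y : ℕ} (hn : 1 ≤ n) (hx : x < 5 * 2 ^ n) (hy : y < 5 * 2 ^ n)
    (h : ((x % 5 = 1 ∨ x % 5 = 4) ∧ (y % 5 = 2 ∨ y % 5 = 3)) ∨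
      ((x % 5 = 2 ∨ x % 5 = 3) ∧ (y % 5 = 1 ∨ y % 5 = 4))) (hodd : Odd x ∨ Odd y) :
    (Kpair (5 * 2 ^ n))^[n] (sort2 (x, y)) ≠ (3 * 2 ^ n, 2 ^ n) := by
  have hs : ¬ (5 : ℤ) ∣ x - y := by omega
  have ha : ¬ (5 : ℤ) ∣ x + y := by omega
  rw [Kpair_iterate_of_not_dvd n hx hy (not_dvd_of_not_five_dvd (by omega) _)
    (not_dvd_of_not_five_dvd (by omega) _) (not_dvd_of_not_five_dvd hs _)
    (not_dvd_of_not_five_dvd ha _)]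
  intro heq
  simp only [sort2, Prod.mk.injEq] at heq
  rcases hodd with h | h
  · have := tent_iterate_ne_of_odd hn h
    omega
  · have := tent_iterate_ne_of_odd hn h
    omega

end Dynamics

section Segments

variable {n : ℕ}

theorem Kpair_balanced {e e' : ℕ} (he : e < 5 * 2 ^ n) (he' : e' < 5 * 2 ^ n) (hpos : 0 < e)
    (hpos' : 0 < e') (hbal : e = e' ∨ e + e' = 5 * 2 ^ n) (hn : 1 ≤ n) :
    ∃ p q : ℕ, Kpair (5 * 2 ^ n) (sort2 (e, e')) = sort2 (p, q) ∧ p < 5 * 2 ^ n ∧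
      q < 5 * 2 ^ n ∧ Odd p ∧ Odd q ∧
      p = (2 * (e : ℤ) - 5 * 2 ^ n + 1).natAbs ∧ q = (2 * (e : ℤ) - 5 * 2 ^ n - 1).natAbs := by
  refine ⟨_, _, Kpair_sort2_of_balanced hpos hpos' hbal, ?_, ?_, ?_, ?_, ?_, ?_⟩
  all_goals
    obtain ⟨k, rfl⟩ := Nat.exists_eq_add_of_le' hn
    push_cast
    simp only [pow_succ] at *
  · zify at *; rw [abs_lt]; constructor <;> linarith
  · zify at *; rw [abs_lt]; constructor <;> linarith
  · rw [Int.natAbs_odd, Int.odd_iff]; omega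
  · rw [Int.natAbs_odd, Int.odd_iff]; omega

theorem Kpair_iterate_balanced_one {e e' : ℕ} (he : e < 5 * 2 ^ n) (he' : e' < 5 * 2 ^ n)
    (hbal : e = e' ∨ e + e' = 5 * 2 ^ n) (hn : 1 ≤ n) (h5 : e % 5 = 1 ∨ e % 5 = 4) :
    (Kpair (5 * 2 ^ n))^[n + 2] (sort2 (e, e')) = (3 * 2 ^ n, 2 ^ n) ∧
      (Kpair (5 * 2 ^ n))^[n + 1] (sort2 (e, e')) ≠ (3 * 2 ^ n, 2 ^ n) := by
  obtain ⟨p, q, h, hp, hq, hpo, hqo, hpe, hqe⟩ :=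
    Kpair_balanced he he' (by omega) (by omega) hbal hn
  have hpq : ((p % 5 = 1 ∨ p % 5 = 4) ∧ (q % 5 = 2 ∨ q % 5 = 3)) ∨
      ((p % 5 = 2 ∨ p % 5 = 3) ∧ (q % 5 = 1 ∨ q % 5 = 4)) := by
    generalize (2 : ℤ) ^ n = N at hpe hqe
    clear h hp hq hpo hqo he he' hbal
    omega
  constructor
  · rw [Function.iterate_succ_apply, h]
    exact Kpair_iterate_eq_fixed hp hq hpq
  · rw [Function.iterate_succ_apply, h]
    exact Kpair_iterate_ne_fixed hn hp hq hpq (Or.inl hpo)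

theorem Kpair_iterate_balanced_two {e e' : ℕ} (he : e < 5 * 2 ^ n) (he' : e' < 5 * 2 ^ n)
    (hbal : e = e' ∨ e + e' = 5 * 2 ^ n) (hn : 1 ≤ n) (h5 : e % 5 = 2 ∨ e % 5 = 3) :
    (Kpair (5 * 2 ^ n))^[n + 1] (sort2 (e, e')) = sort2 (2 ^ (n + 1), 0) := by
  obtain ⟨p, q, h, hp, hq, hpo, hqo, hpe, hqe⟩ :=
    Kpair_balanced he he' (by omega) (by omega) hbal hn
  have hpq : (p % 5 = 0 ∧ (q % 5 = 2 ∨ q % 5 = 3)) ∨ (q % 5 = 0 ∧ (p % 5 = 2 ∨ p % 5 = 3)) := by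
    generalize (2 : ℤ) ^ n = N at hpe hqe
    clear h hp hq hpo hqo he he' hbal
    omega
  rw [Function.iterate_succ_apply, h]
  rw [Kpair_iterate_of_not_dvd n hp hq (not_dvd_of_odd (by exact_mod_cast hpo) le_rfl)
    (not_dvd_of_odd (by exact_mod_cast hqo) le_rfl)
    (not_dvd_of_not_five_dvd (by omega) _) (not_dvd_of_not_five_dvd (by omega) _)]
  have hzero : ∀ z : ℕ, z < 5 * 2 ^ n → Odd z → z % 5 = 0 → (tent (5 * 2 ^ n))^[n] z = 0 := by
    intro z hz hzo hz5
    obtain ⟨o, rfl⟩ := Nat.dvd_of_mod_eq_zero hz5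
    have := tent_iterate_eq_zero (n := n) (i := 0) (Nat.odd_mul.1 hzo).2 (zero_add n) hn
      (by simpa using hz.le)
    simpa using this
  rcases hpq with ⟨h1, h2⟩ | ⟨h1, h2⟩
  · rw [hzero p hp hpo h1, tent_iterate_eq_two_pow_succ hn hq hqo h2, sort2_comm]
  · rw [hzero q hq hqo h1, tent_iterate_eq_two_pow_succ hn hp hpo h2]

theorem Kpair_iterate_single_of_two_or_four {x : ℕ} (hx : x < 5 * 2 ^ n) (hn : 1 ≤ n)
    (h5 : x % 5 = 2 ∨ x % 5 = 4) :
    (Kpair (5 * 2 ^ n))^[n + 2] (sort2 (x, 0)) = (3 * 2 ^ n, 2 ^ n) ∧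
      (Kpair (5 * 2 ^ n))^[n + 1] (sort2 (x, 0)) ≠ (3 * 2 ^ n, 2 ^ n) := by
  have hev : 2 ^ n % 2 = 0 := Nat.even_iff.1 ((Nat.even_pow' (by omega)).2 even_two)
  have hpq : (((x - 1) % 5 = 1 ∨ (x - 1) % 5 = 4) ∧
      ((5 * 2 ^ n - x) % 5 = 2 ∨ (5 * 2 ^ n - x) % 5 = 3)) ∨
      (((x - 1) % 5 = 2 ∨ (x - 1) % 5 = 3) ∧
      ((5 * 2 ^ n - x) % 5 = 1 ∨ (5 * 2 ^ n - x) % 5 = 4)) := by omega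
  constructor
  · rw [Function.iterate_succ_apply, Kpair_sort2_zero (by omega)]
    exact Kpair_iterate_eq_fixed (by omega) (by omega) hpq
  · rw [Function.iterate_succ_apply, Kpair_sort2_zero (by omega)]
    refine Kpair_iterate_ne_fixed hn (by omega) (by omega) hpq ?_
    rw [Nat.odd_iff, Nat.odd_iff]; omega

theorem Kpair_iterate_single_of_three {x : ℕ} (hx : x < 5 * 2 ^ n) (hn : 1 ≤ n) (h5 : x % 5 = 3) :
    ∃ e e', (Kpair (5 * 2 ^ n))^[n + 1] (sort2 (x, 0)) = sort2 (e, e') ∧ e < 5 * 2 ^ n ∧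
      e' < 5 * 2 ^ n ∧ (e = e' ∨ e + e' = 5 * 2 ^ n) ∧
      (Even n → e % 5 = 2 ∨ e % 5 = 3) ∧ (Odd n → e % 5 = 1 ∨ e % 5 = 4) := by
  obtain ⟨y, rfl⟩ := Nat.exists_eq_add_of_le' (show 1 ≤ x by omega)
  rw [Function.iterate_succ_apply, Kpair_sort2_zero (by omega), Nat.add_sub_cancel]
  obtain ⟨z, hz⟩ := Nat.exists_eq_add_of_le hx.le
  have hzz : 5 * 2 ^ n - (y + 1) = z := by omega
  rw [hzz]
  have hz5 : z % 5 = 2 := by omega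
  have hy : y < 5 * 2 ^ n := by omega
  have hzl : z < 5 * 2 ^ n := by omega
  have e5 : ∀ v : ℕ, v ≤ 5 * 2 ^ n → v % 5 ≠ 0 → v < 5 * 2 ^ n := by
    intro v hv h; omega
  rw [Kpair_iterate_of_not_dvd n hy hzl (not_dvd_of_not_five_dvd (by omega) _)
    (not_dvd_of_not_five_dvd (by omega) _) ?_ (not_dvd_of_not_five_dvd (by omega) _)]
  · refine ⟨_, _, rfl, e5 _ (tent_iterate_le hy.le _) ?_, e5 _ (tent_iterate_le hzl.le _) ?_,
      tent_iterate_balanced n hy.le hzl.le ?_, ?_, ?_⟩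
    · exact tent_iterate_mod_five_ne_zero _ (by omega)
    · exact tent_iterate_mod_five_ne_zero _ (by omega)
    · left
      obtain ⟨q, hq⟩ : (5 : ℤ) ∣ y - z := by omega
      refine ⟨q, ?_⟩
      rw [hq]; push_cast; ring
    · intro h; exact (tent_iterate_mod_five_of_even h y).2 (by omega)
    · intro h; exact (tent_iterate_mod_five_of_odd h y).2 (by omega)
  · refine not_dvd_of_odd ?_ le_rfl
    have hev : 2 ^ n % 2 = 0 := Nat.even_iff.1 ((Nat.even_pow' (by omega)).2 even_two)
    rw [Int.odd_iff]; omega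

/-- A multiple of `5` and its complement to `b - 1`. -/
theorem Kpair_iterate_complement {i j o y : ℕ} (ho : Odd o) (hij : i + j = n) (hj : 1 ≤ j)
    (hy : 5 * 2 ^ i * o + y + 1 = 5 * 2 ^ n) :
    (Kpair (5 * 2 ^ n))^[j] (sort2 (5 * 2 ^ i * o, y)) = sort2 (2 ^ j, 0) := by
  have hlt : 5 * 2 ^ i * o < 5 * 2 ^ n := by omega
  have hylt : y < 5 * 2 ^ n := by omega
  have hjn : 2 ^ j ≤ 2 ^ n := Nat.pow_le_pow_right (by norm_num) (by omega)
  have h1 := tent_iterate_eq_zero ho hij hj hlt.le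
  have h2 : (tent (5 * 2 ^ n))^[j] y = 2 ^ j := by
    refine tent_iterate_eq_of_dvd hj hylt.le (by omega) (Or.inr ?_)
    have hyz : (y : ℤ) = 5 * 2 ^ n - 1 - 5 * 2 ^ i * o := by zify at hy; linarith
    obtain ⟨c, rfl⟩ := ho
    obtain ⟨k, rfl⟩ := Nat.exists_eq_add_of_le' hj
    refine ⟨2 ^ k - c - 1, ?_⟩
    rw [hyz, ← hij]
    push_cast
    ring
  have hpos : 0 < 2 ^ j := by positivity
  have hpos' : 0 < 2 ^ n := by positivity
  rw [Kpair_iterate_of_tent_ne j, h1, h2, sort2_comm]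
  · rw [h1, h2]; omega
  · rw [h1]; omega
  · rw [h2]; omega

theorem Kpair_iterate_single_zero {i j o : ℕ} (ho : Odd o) (hij : i + j = n) (hj : 1 ≤ j)
    (hlt : 5 * 2 ^ i * o < 5 * 2 ^ n) :
    (Kpair (5 * 2 ^ n))^[j + 1] (sort2 (5 * 2 ^ i * o, 0)) = sort2 (2 ^ j, 0) := by
  have hlt' : 2 ^ i * o < 2 ^ n := by nlinarith
  have hpos : 0 < 2 ^ i * o := Nat.mul_pos (by positivity) ho.pos
  rw [Function.iterate_succ_apply, Kpair_sort2_zero (by nlinarith), sort2_comm]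
  have hsplit : 2 ^ n = 2 ^ i * 2 ^ j := by rw [← pow_add, hij]
  have hoj : o < 2 ^ j := by
    rw [hsplit] at hlt'; exact Nat.lt_of_mul_lt_mul_left hlt'
  obtain ⟨t, ht⟩ := Nat.exists_eq_add_of_le hoj.le
  have hto : Odd t := by
    have : Even (o + t) := ht ▸ (Nat.even_pow' (by omega)).2 even_two
    rw [Nat.even_add'] at this
    exact this.1 ho
  have e : 5 * 2 ^ n - 5 * 2 ^ i * o = 5 * 2 ^ i * t := by
    rw [hsplit, ht]
    apply Nat.sub_eq_of_eq_add
    ring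
  have hpow : 0 < 2 ^ i * t := Nat.mul_pos (by positivity) hto.pos
  rw [e]
  refine Kpair_iterate_complement hto hij hj ?_
  have : 5 * 2 ^ n = 5 * 2 ^ i * o + 5 * 2 ^ i * t := by rw [hsplit, ht]; ring
  have : 0 < 5 * 2 ^ i * o := by nlinarith
  omega

theorem Kpair_iterate_single_one {i j o : ℕ} (ho : Odd o) (hij : i + j = n) (hj : 1 ≤ j)
    (hlt : 5 * 2 ^ i * o + 1 < 5 * 2 ^ n) :
    (Kpair (5 * 2 ^ n))^[j + 1] (sort2 (5 * 2 ^ i * o + 1, 0)) = sort2 (2 ^ j, 0) := by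
  rw [Function.iterate_succ_apply, Kpair_sort2_zero (by omega), Nat.add_sub_cancel]
  exact Kpair_iterate_complement ho hij hj (by omega)

theorem exists_odd_part {x : ℕ} (h5 : x % 5 = 0) (hx : 0 < x) (hlt : x < 5 * 2 ^ n) :
    ∃ i j o, Odd o ∧ i + j = n ∧ 1 ≤ j ∧ x = 5 * 2 ^ i * o := by
  obtain ⟨w, rfl⟩ := Nat.dvd_of_mod_eq_zero h5
  obtain ⟨i, o, ho, rfl⟩ := Nat.exists_eq_two_pow_mul_odd (n := w) (by omega)
  have hi : 2 ^ i < 2 ^ n := by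
    have := Nat.le_mul_of_pos_right (2 ^ i) ho.pos
    omega
  have hin : i < n := (Nat.pow_lt_pow_iff_right (by norm_num)).1 hi
  exact ⟨i, n - i, o, ho, by omega, by omega, by ring⟩

end Segments

section Basin

variable {n : ℕ}

/-- The iterates of the pair `p` reach the fixed pair `(3b/5, b/5)`, where `b = 5·2^n`. -/
def InBasin (n : ℕ) (p : ℕ × ℕ) : Prop :=
  ∃ t, (Kpair (5 * 2 ^ n))^[t] p = (3 * 2 ^ n, 2 ^ n)

theorem Kpair_fixed (n : ℕ) : Kpair (5 * 2 ^ n) (3 * 2 ^ n, 2 ^ n) = (3 * 2 ^ n, 2 ^ n) := by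
  have hN : 0 < 2 ^ n := by positivity
  have h : sort2 (3 * 2 ^ n, 2 ^ n) = (3 * 2 ^ n, 2 ^ n) := by
    simp only [sort2, Prod.mk.injEq]; omega
  conv_lhs => rw [← h]
  rw [Kpair_sort2_of_generic (by omega) hN (by omega) (by omega)]
  simp only [sort2, tent, Prod.mk.injEq]
  generalize 2 ^ n = N at *
  omega

theorem Kpair_iterate_eq_of_add_le {p q : ℕ × ℕ} {a k m : ℕ}
    (hpq : (Kpair (5 * 2 ^ n))^[a] p = q)
    (hq : (Kpair (5 * 2 ^ n))^[k] q = (3 * 2 ^ n, 2 ^ n)) (hm : a + k ≤ m) :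
    (Kpair (5 * 2 ^ n))^[m] p = (3 * 2 ^ n, 2 ^ n) := by
  obtain ⟨c, rfl⟩ := Nat.exists_eq_add_of_le' hm
  rw [Function.iterate_add_apply, add_comm a k, Function.iterate_add_apply, hpq, hq]
  exact Function.iterate_fixed (Kpair_fixed n) c

theorem Kpair_iterate_eq_of_le {p : ℕ × ℕ} {k m : ℕ}
    (h : (Kpair (5 * 2 ^ n))^[k] p = (3 * 2 ^ n, 2 ^ n)) (hm : k ≤ m) :
    (Kpair (5 * 2 ^ n))^[m] p = (3 * 2 ^ n, 2 ^ n) :=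
  Kpair_iterate_eq_of_add_le (a := 0) rfl h (by omega)

theorem InBasin.iterate {p q : ℕ × ℕ} {a : ℕ} (h : InBasin n p)
    (hpq : (Kpair (5 * 2 ^ n))^[a] p = q) : InBasin n q := by
  obtain ⟨t, ht⟩ := h
  refine ⟨t, ?_⟩
  rw [← hpq, ← Function.iterate_add_apply]
  exact Kpair_iterate_eq_of_le ht (by omega)

theorem not_inBasin_of_periodic {p : ℕ × ℕ} {m : ℕ} (hm : 1 ≤ m)
    (hp : (Kpair (5 * 2 ^ n))^[m] p = p) (hne : p ≠ (3 * 2 ^ n, 2 ^ n)) : ¬ InBasin n p := by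
  rintro ⟨t, ht⟩
  apply hne
  have h1 := Function.IsPeriodicPt.mul_const (f := Kpair (5 * 2 ^ n))
    (show Function.IsPeriodicPt _ m p from hp) t
  rw [← Kpair_iterate_eq_of_le ht (show t ≤ m * t by nlinarith)]
  exact h1.symm

theorem two_pow_mod_five (j : ℕ) : (j % 4 = 0 → 2 ^ j % 5 = 1) ∧ (j % 4 = 1 → 2 ^ j % 5 = 2) ∧
    (j % 4 = 2 → 2 ^ j % 5 = 4) ∧ (j % 4 = 3 → 2 ^ j % 5 = 3) := by
  have h : 2 ^ j % 5 = 2 ^ (j % 4) % 5 := by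
    conv_lhs => rw [← Nat.div_add_mod j 4, pow_add, pow_mul, Nat.mul_mod, Nat.pow_mod]
    norm_num
  refine ⟨?_, ?_, ?_, ?_⟩ <;> intro h' <;> rw [h, h'] <;> rfl

theorem sort2_zero_ne (x : ℕ) : sort2 (x, 0) ≠ (3 * 2 ^ n, 2 ^ n) := by
  have hN : 0 < 2 ^ n := by positivity
  simp only [sort2, Ne, Prod.mk.injEq]
  omega

theorem Kpair_iterate_single_even {x : ℕ} (hx : x < 5 * 2 ^ n) (hn : 1 ≤ n) (he : Even x)
    (h5 : x % 5 = 1) :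
    (Kpair (5 * 2 ^ n))^[n + 1] (sort2 (x, 0)) = sort2 (2 ^ n, 0) := by
  rw [Nat.even_iff] at he
  obtain ⟨o, ho⟩ : ∃ o, x = 5 * o + 1 := ⟨x / 5, by omega⟩
  have h := Kpair_iterate_single_one (n := n) (i := 0) (j := n) (o := o)
    (by rw [Nat.odd_iff]; omega) (by omega) hn (by omega)
  simpa [ho] using h

theorem not_inBasin_two_pow_succ (hn : n % 4 = 2) : ¬ InBasin n (sort2 (2 ^ (n + 1), 0)) := by
  have hN : 0 < 2 ^ n := by positivity
  obtain ⟨e, e', h, he, he', hb, h2, -⟩ := Kpair_iterate_single_of_three (n := n)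
    (x := 2 ^ (n + 1)) (by rw [pow_succ]; omega) (by omega)
    ((two_pow_mod_five _).2.2.2 (by omega))
  have h3 := Kpair_iterate_balanced_two he he' hb (by omega) (h2 (by rw [Nat.even_iff]; omega))
  refine not_inBasin_of_periodic (m := (n + 1) + (n + 1)) (by omega) ?_ (sort2_zero_ne _)
  rw [Function.iterate_add_apply, h, h3]

theorem not_inBasin_two_pow (hn : n % 4 = 0) (hn1 : 1 ≤ n) : ¬ InBasin n (sort2 (2 ^ n, 0)) := by
  have hN : 0 < 2 ^ n := by positivity
  exact not_inBasin_of_periodic (m := n + 1) (by omega)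
    (Kpair_iterate_single_even (by omega) hn1 ((Nat.even_pow' (by omega)).2 even_two)
      ((two_pow_mod_five _).1 hn)) (sort2_zero_ne _)

/-- Bound for the number of steps from `(x, 0)` with `x` even and prime to `5`. -/
def singleBound (n : ℕ) : ℕ := if n % 4 = 0 ∨ n % 4 = 3 then 3 * n + 4 else 2 * n + 3

/-- Bound for the number of steps from a type (b) pair prime to `5`. -/
def balancedBound (n : ℕ) : ℕ := if n % 4 = 3 then 4 * n + 5 else 2 * n + 3

/-- The largest number of steps from any pair. -/
def maxDepth (n : ℕ) : ℕ :=
  if n % 4 = 0 then 4 * n + 5 else if n % 4 = 3 then 5 * n + 5 else 3 * n + 4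

theorem singleBound_add_le (n : ℕ) : singleBound n + (n + 1) ≤ maxDepth n := by
  unfold singleBound maxDepth; split_ifs <;> omega

theorem balancedBound_add_le (n : ℕ) : balancedBound n + n ≤ maxDepth n := by
  unfold balancedBound maxDepth; split_ifs <;> omega

theorem single_three_of_odd {x : ℕ} (hx : x < 5 * 2 ^ n) (hn : Odd n) (h5 : x % 5 = 3) :
    (Kpair (5 * 2 ^ n))^[2 * n + 3] (sort2 (x, 0)) = (3 * 2 ^ n, 2 ^ n) := by
  obtain ⟨e, e', h, he, he', hb, -, h2⟩ := Kpair_iterate_single_of_three hx hn.pos h5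
  exact Kpair_iterate_eq_of_add_le h
    (Kpair_iterate_balanced_one he he' hb hn.pos (h2 hn)).1 (by omega)

theorem balanced_le {e e' : ℕ} (hn : 1 ≤ n) (he : e < 5 * 2 ^ n) (he' : e' < 5 * 2 ^ n)
    (hb : e = e' ∨ e + e' = 5 * 2 ^ n) (h5 : e % 5 ≠ 0) (hbas : InBasin n (sort2 (e, e'))) :
    (Kpair (5 * 2 ^ n))^[balancedBound n] (sort2 (e, e')) = (3 * 2 ^ n, 2 ^ n) := by
  have hN : 0 < 2 ^ n := by positivity
  have hle : 2 * n + 3 ≤ balancedBound n := by unfold balancedBound; split_ifs <;> omega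
  by_cases h1 : e % 5 = 1 ∨ e % 5 = 4
  · exact Kpair_iterate_eq_of_le (Kpair_iterate_balanced_one he he' hb hn h1).1 (by omega)
  have h := Kpair_iterate_balanced_two he he' hb hn (by omega)
  have hlt : 2 ^ (n + 1) < 5 * 2 ^ n := by rw [pow_succ]; omega
  obtain ⟨-, m1, m2, -⟩ := two_pow_mod_five (n + 1)
  have hcases : n % 4 = 0 ∨ n % 4 = 1 ∨ n % 4 = 2 ∨ n % 4 = 3 := by omega
  rcases hcases with hc | hc | hc | hc
  · exact Kpair_iterate_eq_of_add_le h (Kpair_iterate_single_of_two_or_four hlt hn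
      (Or.inl (m1 (by omega)))).1 (by omega)
  · exact Kpair_iterate_eq_of_add_le h (Kpair_iterate_single_of_two_or_four hlt hn
      (Or.inr (m2 (by omega)))).1 (by omega)
  · exact absurd (hbas.iterate h) (not_inBasin_two_pow_succ hc)
  · have h' := Kpair_iterate_single_even hlt hn ((Nat.even_pow' (by omega)).2 even_two)
      ((two_pow_mod_five (n + 1)).1 (by omega))
    have h3 := single_three_of_odd (x := 2 ^ n) (n := n) (by omega) (by rw [Nat.odd_iff]; omega)
      ((two_pow_mod_five n).2.2.2 hc)
    refine Kpair_iterate_eq_of_add_le h (Kpair_iterate_eq_of_add_le h' h3 le_rfl) ?_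
    rw [balancedBound, if_pos hc]; omega

theorem single_three_le {x : ℕ} (hn : 1 ≤ n) (hx : x < 5 * 2 ^ n) (h5 : x % 5 = 3)
    (hbas : InBasin n (sort2 (x, 0))) :
    (Kpair (5 * 2 ^ n))^[singleBound n] (sort2 (x, 0)) = (3 * 2 ^ n, 2 ^ n) := by
  have hle : 2 * n + 3 ≤ singleBound n := by unfold singleBound; split_ifs <;> omega
  rcases Nat.even_or_odd n with hev | hodd
  · obtain ⟨e, e', h, he, he', hb, h2, -⟩ := Kpair_iterate_single_of_three hx hn h5
    have h3 := balanced_le hn he he' hb (by have := h2 hev; omega) (hbas.iterate h)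
    rw [Nat.even_iff] at hev
    rw [balancedBound, if_neg (by omega)] at h3
    by_cases h4 : n % 4 = 0
    · refine Kpair_iterate_eq_of_add_le h h3 ?_
      rw [singleBound, if_pos (Or.inl h4)]; omega
    · have h6 := Kpair_iterate_balanced_two he he' hb hn (h2 (by rwa [Nat.even_iff]))
      exact absurd ((hbas.iterate h).iterate h6) (not_inBasin_two_pow_succ (by omega))
  · exact Kpair_iterate_eq_of_le (single_three_of_odd hx hodd h5) hle

theorem single_even_le {x : ℕ} (hn : 1 ≤ n) (hx : x < 5 * 2 ^ n) (he : Even x)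
    (h5 : x % 5 ≠ 0) (hbas : InBasin n (sort2 (x, 0))) :
    (Kpair (5 * 2 ^ n))^[singleBound n] (sort2 (x, 0)) = (3 * 2 ^ n, 2 ^ n) := by
  have hN : 0 < 2 ^ n := by positivity
  have hle : 2 * n + 3 ≤ singleBound n := by unfold singleBound; split_ifs <;> omega
  by_cases h2 : x % 5 = 2 ∨ x % 5 = 4
  · exact Kpair_iterate_eq_of_le (Kpair_iterate_single_of_two_or_four hx hn h2).1 (by omega)
  by_cases h3 : x % 5 = 3
  · exact single_three_le hn hx h3 hbas
  have h := Kpair_iterate_single_even hx hn he (by omega)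
  obtain ⟨-, m1, m2, m3⟩ := two_pow_mod_five n
  have hlt : 2 ^ n < 5 * 2 ^ n := by omega
  have hcases : n % 4 = 0 ∨ n % 4 = 1 ∨ n % 4 = 2 ∨ n % 4 = 3 := by omega
  rcases hcases with hc | hc | hc | hc
  · exact absurd (hbas.iterate h) (not_inBasin_two_pow hc hn)
  · exact Kpair_iterate_eq_of_add_le h (Kpair_iterate_single_of_two_or_four hlt hn
      (Or.inl (m1 hc))).1 (by omega)
  · exact Kpair_iterate_eq_of_add_le h (Kpair_iterate_single_of_two_or_four hlt hn
      (Or.inr (m2 hc))).1 (by omega)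
  · refine Kpair_iterate_eq_of_add_le h
      (single_three_of_odd hlt (by rw [Nat.odd_iff]; omega) (m3 hc)) ?_
    rw [singleBound, if_pos (Or.inr hc)]; omega

theorem single_two_pow_le {j : ℕ} (hj : 1 ≤ j) (hjn : j ≤ n)
    (hbas : InBasin n (sort2 (2 ^ j, 0))) :
    (Kpair (5 * 2 ^ n))^[singleBound n] (sort2 (2 ^ j, 0)) = (3 * 2 ^ n, 2 ^ n) := by
  have hpow : 2 ^ j ≤ 2 ^ n := Nat.pow_le_pow_right (by norm_num) hjn
  have hN : 0 < 2 ^ n := by positivity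
  have := two_pow_mod_five j
  exact single_even_le (by omega) (by omega) ((Nat.even_pow' (by omega)).2 even_two) (by omega) hbas

theorem single_five_dvd_le {i j o : ℕ} (ho : Odd o) (hij : i + j = n) (hj : 1 ≤ j)
    (hlt : 5 * 2 ^ i * o < 5 * 2 ^ n) (hbas : InBasin n (sort2 (5 * 2 ^ i * o, 0))) :
    (Kpair (5 * 2 ^ n))^[j + 1 + singleBound n] (sort2 (5 * 2 ^ i * o, 0)) =
      (3 * 2 ^ n, 2 ^ n) := by
  have h := Kpair_iterate_single_zero ho hij hj hlt
  exact Kpair_iterate_eq_of_add_le h (single_two_pow_le hj (by omega) (hbas.iterate h)) le_rfl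

theorem single_le {x : ℕ} (hn : 1 ≤ n) (hpos : 0 < x) (hx : x < 5 * 2 ^ n)
    (hbas : InBasin n (sort2 (x, 0))) :
    (Kpair (5 * 2 ^ n))^[n + 1 + singleBound n] (sort2 (x, 0)) = (3 * 2 ^ n, 2 ^ n) := by
  have hle : 2 * n + 3 ≤ singleBound n := by unfold singleBound; split_ifs <;> omega
  have hcases : x % 5 = 0 ∨ x % 5 = 1 ∨ (x % 5 = 2 ∨ x % 5 = 4) ∨ x % 5 = 3 := by omega
  rcases hcases with h5 | h5 | h5 | h5
  · obtain ⟨i, j, o, ho, hij, hj, rfl⟩ := exists_odd_part h5 hpos hx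
    exact Kpair_iterate_eq_of_le (single_five_dvd_le ho hij hj hx hbas) (by omega)
  · rcases Nat.eq_or_lt_of_le (show 1 ≤ x from hpos) with rfl | h1
    · have h : (Kpair (5 * 2 ^ n))^[1] (sort2 (1, 0)) = sort2 (5 * 2 ^ n - 1, 0) := by
        rw [Function.iterate_one, Kpair_sort2_zero (by omega), sort2_comm]
      exact Kpair_iterate_eq_of_add_le h (Kpair_iterate_single_of_two_or_four (by omega) hn
        (by omega)).1 (by omega)
    · obtain ⟨y, rfl⟩ : ∃ y, x = y + 1 := ⟨x - 1, by omega⟩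
      obtain ⟨i, j, o, ho, hij, hj, rfl⟩ :=
        exists_odd_part (n := n) (x := y) (by omega) (by omega) (by omega)
      have h := Kpair_iterate_single_one ho hij hj hx
      exact Kpair_iterate_eq_of_add_le h (single_two_pow_le hj (by omega) (hbas.iterate h))
        (by omega)
  · exact Kpair_iterate_eq_of_le (Kpair_iterate_single_of_two_or_four hx hn h5).1 (by omega)
  · exact Kpair_iterate_eq_of_le (single_three_le hn hx h5 hbas) (by omega)

end Basin

section UpperBound

variable {n : ℕ}

theorem not_dvd_of_eq_two_pow_mul {z c : ℤ} {w m : ℕ} (hc : Odd c) (hz : z = 2 ^ w * c)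
    (h : m + w ≤ n) : ¬ (2 * ((5 * 2 ^ n : ℕ) : ℤ)) ∣ 2 ^ m * z := by
  rw [hz, ← mul_assoc, ← pow_add]
  exact not_dvd_of_odd hc h

theorem Kpair_iterate_merge {x y m w : ℕ} {s z c : ℤ} (hx : x < 5 * 2 ^ n) (hy : y < 5 * 2 ^ n)
    (hsz : (x - y = z ∧ x + y = s) ∨ (x - y = s ∧ (x : ℤ) + y = z)) (hmw : m + w = n)
    (hz : z = 5 * 2 ^ w * c) (hc : Odd c)
    (hxm : ¬ (2 * ((5 * 2 ^ n : ℕ) : ℤ)) ∣ 2 ^ m * x)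
    (hym : ¬ (2 * ((5 * 2 ^ n : ℕ) : ℤ)) ∣ 2 ^ m * y)
    (hsm : ¬ (2 * ((5 * 2 ^ n : ℕ) : ℤ)) ∣ 2 ^ m * s) :
    (Kpair (5 * 2 ^ n))^[m] (sort2 (x, y)) =
      sort2 ((tent (5 * 2 ^ n))^[m] x, (tent (5 * 2 ^ n))^[m] y) ∧
    ((tent (5 * 2 ^ n))^[m] x = (tent (5 * 2 ^ n))^[m] y ∨
      (tent (5 * 2 ^ n))^[m] x + (tent (5 * 2 ^ n))^[m] y = 5 * 2 ^ n) := by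
  have hzm : ¬ (2 * ((5 * 2 ^ n : ℕ) : ℤ)) ∣ 2 ^ m * z :=
    not_dvd_of_eq_two_pow_mul (c := 5 * c) (w := w) (Odd.mul (by decide) hc)
      (by rw [hz]; ring) hmw.le
  have hdvd : (2 * ((5 * 2 ^ n : ℕ) : ℤ)) ∣ 2 ^ (m + 1) * z :=
    ⟨c, by rw [hz]; push_cast; rw [← hmw]; ring⟩
  refine ⟨Kpair_iterate_of_not_dvd m hx hy hxm hym ?_ ?_,
    tent_iterate_balanced m hx.le hy.le ?_⟩ <;>
  rcases hsz with ⟨h1, h2⟩ | ⟨h1, h2⟩ <;> simp only [h1, h2] <;>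
  first | assumption | exact Or.inl hdvd | exact Or.inr hdvd

theorem exists_five_mul_two_pow_mul_odd {z : ℤ} (h0 : z ≠ 0) (h5 : 5 ∣ z)
    (hlt : |z| < 2 * (5 * 2 ^ n)) : ∃ (w : ℕ) (c : ℤ), Odd c ∧ w ≤ n ∧ z = 5 * 2 ^ w * c := by
  obtain ⟨t, rfl⟩ := h5
  obtain ⟨w, o, ho, hw⟩ := Nat.exists_eq_two_pow_mul_odd (n := t.natAbs) (by omega)
  have h2 : 2 ^ w < 2 ^ (n + 1) := by
    have h3 := Nat.le_mul_of_pos_right (2 ^ w) ho.pos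
    have h4 : ((t.natAbs : ℕ) : ℤ) < 2 ^ (n + 1) := by
      rw [abs_mul, Int.abs_eq_natAbs t] at hlt
      norm_num at hlt
      rw [pow_succ]; simp only [Int.natCast_natAbs]; linarith
    rw [← hw] at h3
    have : t.natAbs < 2 ^ (n + 1) := by exact_mod_cast h4
    omega
  have hwn : w < n + 1 := (Nat.pow_lt_pow_iff_right (by norm_num)).1 h2
  have ho' : Odd (o : ℤ) := by exact_mod_cast ho
  rcases Int.natAbs_eq t with ht | ht
  · exact ⟨w, o, ho', by omega, by rw [ht, hw]; push_cast; ring⟩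
  · exact ⟨w, -o, ho'.neg, by omega, by rw [ht, hw]; push_cast; ring⟩

theorem balanced_five_dvd_le {e' o u j : ℕ} (ho : Odd o) (huj : u + j = n) (hj : 1 ≤ j)
    (he : 5 * 2 ^ u * o < 5 * 2 ^ n) (he' : e' < 5 * 2 ^ n)
    (hb : 5 * 2 ^ u * o = e' ∨ 5 * 2 ^ u * o + e' = 5 * 2 ^ n)
    (hbas : InBasin n (sort2 (5 * 2 ^ u * o, e'))) :
    (Kpair (5 * 2 ^ n))^[j + balancedBound n] (sort2 (5 * 2 ^ u * o, e')) =
      (3 * 2 ^ n, 2 ^ n) := by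
  have hn : 1 ≤ n := by omega
  have hpos : 0 < 5 * 2 ^ u * o := Nat.mul_pos (by positivity) ho.pos
  obtain ⟨p, q, h, hp, hq, hpo, hqo, hpe, hqe⟩ :=
    Kpair_balanced he he' hpos (by omega) hb hn
  rw [← Function.iterate_one (Kpair (5 * 2 ^ n))] at h
  set C : ℤ := 2 ^ (j - 1) with hC
  have hC2 : (2 : ℤ) ^ n = 2 ^ (u + 1) * C := by
    rw [hC, ← pow_add]; congr 1; omega
  have hD : 2 * ((5 * 2 ^ u * o : ℕ) : ℤ) - 5 * 2 ^ n = 5 * 2 ^ (u + 1) * (o - C) := by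
    push_cast; rw [hC2]; ring
  rw [hD] at hpe hqe
  rcases Nat.eq_or_lt_of_le hj with rfl | hj2
  · have ho1 : o = 1 := by
      have h1 : 2 ^ u * o < 2 ^ u * 2 := by rw [← pow_succ, huj]; nlinarith
      have := Nat.lt_of_mul_lt_mul_left h1
      have := ho.pos
      omega
    subst ho1
    simp only [hC, Nat.sub_self, pow_zero, Nat.cast_one, sub_self, mul_zero] at hpe hqe
    have hp1 : p = 1 := by rw [hpe]; rfl
    have hq1 : q = 1 := by rw [hqe]; rfl
    subst hp1 hq1
    exact Kpair_iterate_eq_of_add_le h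
      (balanced_le hn hp hq (Or.inl rfl) (by norm_num) (hbas.iterate h)) le_rfl
  · have hodd : Odd ((o : ℤ) - C) := by
      have h1 : Odd (o : ℤ) := by exact_mod_cast ho
      exact h1.sub_even ((Int.even_pow' (by omega)).2 even_two)
    have h5 : (5 : ℤ) ∣ 5 * 2 ^ (u + 1) * (o - C) := ⟨2 ^ (u + 1) * (o - C), by ring⟩
    have hD0 : 5 * 2 ^ (u + 1) * ((o : ℤ) - C) ≠ 0 := by
      have : (o : ℤ) - C ≠ 0 := by rintro h0; rw [h0] at hodd; exact absurd hodd (by decide)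
      positivity
    have key : ∃ (s c : ℤ), ((p : ℤ) - q = s) ∧ ¬ 5 ∣ s ∧ Odd c ∧
        (p : ℤ) + q = 5 * 2 ^ (u + 2) * c := by
      have hdbl : 2 * (5 * 2 ^ (u + 1) * ((o : ℤ) - C)) = 5 * 2 ^ (u + 2) * (o - C) := by ring
      rcases lt_or_gt_of_ne hD0 with hlt | hgt
      · refine ⟨-2, -(o - C), by omega, by norm_num, hodd.neg, ?_⟩
        rw [mul_neg, ← hdbl]; omega
      · refine ⟨2, o - C, by omega, by norm_num, hodd, ?_⟩
        rw [← hdbl]; omega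
    obtain ⟨s, c, hs, hs5, hc, hz⟩ := key
    obtain ⟨hm, hbal⟩ := Kpair_iterate_merge (m := j - 2) (w := u + 2) hp hq
      (Or.inr ⟨hs, hz⟩) (by omega) rfl hc
      (not_dvd_of_not_five_dvd (by omega) _) (not_dvd_of_not_five_dvd (by omega) _)
      (not_dvd_of_not_five_dvd hs5 _)
    have hp5 : (tent (5 * 2 ^ n))^[j - 2] p % 5 ≠ 0 :=
      tent_iterate_mod_five_ne_zero _ (by omega)
    have hq5 : (tent (5 * 2 ^ n))^[j - 2] q % 5 ≠ 0 :=
      tent_iterate_mod_five_ne_zero _ (by omega)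
    have hple := tent_iterate_le hp.le (j - 2)
    have hqle := tent_iterate_le hq.le (j - 2)
    have hfin := balanced_le hn (by omega) (by omega) hbal hp5
      ((hbas.iterate h).iterate hm)
    exact Kpair_iterate_eq_of_add_le h (Kpair_iterate_eq_of_add_le hm hfin le_rfl) (by omega)

/-- Pairs whose entries agree up to sign modulo `5` and are prime to `5`. -/
theorem congruent_le {x y : ℕ} (hn : 1 ≤ n) (hx : x < 5 * 2 ^ n) (hy : y < 5 * 2 ^ n)
    (hne : x ≠ y) (hx5 : x % 5 ≠ 0) (h : x % 5 = y % 5 ∨ (x + y) % 5 = 0)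
    (hbas : InBasin n (sort2 (x, y))) :
    (Kpair (5 * 2 ^ n))^[n + balancedBound n] (sort2 (x, y)) = (3 * 2 ^ n, 2 ^ n) := by
  obtain ⟨s, z, hsz, hs5, hz5⟩ : ∃ s z : ℤ, ((x - y = z ∧ x + y = s) ∨
      (x - y = s ∧ (x : ℤ) + y = z)) ∧ ¬ 5 ∣ s ∧ 5 ∣ z := by
    rcases h with h | h
    · exact ⟨x + y, x - y, Or.inl ⟨rfl, rfl⟩, by omega, by omega⟩
    · exact ⟨x - y, x + y, Or.inr ⟨rfl, rfl⟩, by omega, by omega⟩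
  have hx' : (x : ℤ) < 5 * 2 ^ n := by exact_mod_cast hx
  have hy' : (y : ℤ) < 5 * 2 ^ n := by exact_mod_cast hy
  obtain ⟨w, c, hc, hw, hz⟩ := exists_five_mul_two_pow_mul_odd (n := n) (z := z)
    (by omega) hz5 (by rw [abs_lt]; constructor <;> omega)
  obtain ⟨hm, hbal⟩ := Kpair_iterate_merge (m := n - w) hx hy hsz (by omega) hz hc
    (not_dvd_of_not_five_dvd (by omega) _) (not_dvd_of_not_five_dvd (by omega) _)
    (not_dvd_of_not_five_dvd hs5 _)
  have hx5 : (tent (5 * 2 ^ n))^[n - w] x % 5 ≠ 0 := tent_iterate_mod_five_ne_zero _ hx5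
  have hy5 : (tent (5 * 2 ^ n))^[n - w] y % 5 ≠ 0 :=
    tent_iterate_mod_five_ne_zero _ (by omega)
  have hxle := tent_iterate_le hx.le (n - w)
  have hyle := tent_iterate_le hy.le (n - w)
  exact Kpair_iterate_eq_of_add_le hm
    (balanced_le hn (by omega) (by omega) hbal hx5 (hbas.iterate hm)) (by omega)

/-- Pairs with exactly one entry divisible by `5`. -/
theorem five_dvd_left_le {x y : ℕ} (hn : 1 ≤ n) (hx : x < 5 * 2 ^ n) (hy : y < 5 * 2 ^ n)
    (hx0 : 0 < x) (hx5 : x % 5 = 0) (hy5 : y % 5 ≠ 0) (hbas : InBasin n (sort2 (x, y))) :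
    (Kpair (5 * 2 ^ n))^[n + singleBound n] (sort2 (x, y)) = (3 * 2 ^ n, 2 ^ n) := by
  have hN : 0 < 2 ^ n := by positivity
  obtain ⟨i, j, o, ho, hij, hj, rfl⟩ := exists_odd_part hx5 hx0 hx
  have hx' := tent_iterate_eq_zero ho hij hj hx.le
  have hy' : (tent (5 * 2 ^ n))^[j] y % 5 ≠ 0 := tent_iterate_mod_five_ne_zero _ hy5
  have hyle := tent_iterate_le hy.le j
  have hyev : Even ((tent (5 * 2 ^ n))^[j] y) := by
    obtain ⟨k, rfl⟩ := Nat.exists_eq_add_of_le' hj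
    rw [Function.iterate_succ_apply']
    have : 2 ^ n % 2 = 0 := Nat.even_iff.1 ((Nat.even_pow' (by omega)).2 even_two)
    rw [Nat.even_iff, tent]
    omega
  have h := Kpair_iterate_of_tent_ne (b := 5 * 2 ^ n) (x := 5 * 2 ^ i * o) (y := y) j
    (by omega) (by omega) (by omega)
  rw [hx', sort2_comm 0] at h
  exact Kpair_iterate_eq_of_add_le h
    (single_even_le hn (by omega) hyev hy' (hbas.iterate h)) (by omega)

theorem five_dvd_of_lt_le {i j i' o o' : ℕ} (ho : Odd o) (ho' : Odd o') (hij : i + j = n)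
    (hi : i' < i) (hj : 1 ≤ j) (hx : 5 * 2 ^ i * o < 5 * 2 ^ n) (hy : 5 * 2 ^ i' * o' < 5 * 2 ^ n)
    (hbas : InBasin n (sort2 (5 * 2 ^ i * o, 5 * 2 ^ i' * o'))) :
    (Kpair (5 * 2 ^ n))^[n + 1 + singleBound n] (sort2 (5 * 2 ^ i * o, 5 * 2 ^ i' * o')) =
      (3 * 2 ^ n, 2 ^ n) := by
  have hx' := tent_iterate_eq_zero ho hij hj hx.le
  obtain ⟨o₁, ho₁, hy'⟩ :=
    tent_iterate_five_mul_odd (n := n) (i := i') (m := j) ho' (by omega)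
  have hyle := tent_iterate_le hy.le j
  rw [hy'] at hyle
  have hpos : 0 < 5 * 2 ^ (i' + j) * o₁ := Nat.mul_pos (by positivity) ho₁.pos
  have hyb : 5 * 2 ^ (i' + j) * o₁ ≠ 5 * 2 ^ n := by
    intro h
    have h1 : 2 ^ (i' + j) * o₁ = 2 ^ (i' + j) * (2 ^ (i - i')) := by
      rw [← pow_add, show i' + j + (i - i') = n by omega]; nlinarith
    have h2 := Nat.eq_of_mul_eq_mul_left (by positivity) h1
    rw [h2] at ho₁
    exact (Nat.not_even_iff_odd.2 ho₁) ((Nat.even_pow' (by omega)).2 even_two)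
  have h := Kpair_iterate_of_tent_ne (b := 5 * 2 ^ n) (x := 5 * 2 ^ i * o)
    (y := 5 * 2 ^ i' * o') j (by omega) (by have := Nat.two_pow_pos n; omega) (by omega)
  rw [hx', hy', sort2_comm 0] at h
  exact Kpair_iterate_eq_of_add_le h (single_five_dvd_le (j := n - (i' + j)) ho₁ (by omega)
    (by omega) (by omega) (hbas.iterate h)) (by omega)

theorem five_dvd_of_eq_le {i o o' : ℕ} (ho : Odd o) (ho' : Odd o') (hne : o ≠ o')
    (hx : 5 * 2 ^ i * o < 5 * 2 ^ n) (hy : 5 * 2 ^ i * o' < 5 * 2 ^ n)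
    (hbas : InBasin n (sort2 (5 * 2 ^ i * o, 5 * 2 ^ i * o'))) :
    (Kpair (5 * 2 ^ n))^[n + balancedBound n] (sort2 (5 * 2 ^ i * o, 5 * 2 ^ i * o')) =
      (3 * 2 ^ n, 2 ^ n) := by
  have hoz : Odd (o : ℤ) := by exact_mod_cast ho
  have hoz' : Odd (o' : ℤ) := by exact_mod_cast ho'
  obtain ⟨s, z, hsz, hs, hz⟩ : ∃ s z : ℤ, (((o : ℤ) - o' = z ∧ (o : ℤ) + o' = s) ∨
      ((o : ℤ) - o' = s ∧ (o : ℤ) + o' = z)) ∧ s % 4 = 2 ∧ z % 4 = 0 := by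
    rw [Int.odd_iff] at hoz hoz'
    by_cases h : ((o : ℤ) - o') % 4 = 0
    · exact ⟨o + o', o - o', Or.inl ⟨rfl, rfl⟩, by omega, by omega⟩
    · exact ⟨o - o', o + o', Or.inr ⟨rfl, rfl⟩, by omega, by omega⟩
  have hx' : (5 : ℤ) * 2 ^ i * o < 5 * 2 ^ n := by exact_mod_cast hx
  have hy' : (5 : ℤ) * 2 ^ i * o' < 5 * 2 ^ n := by exact_mod_cast hy
  have hxp : (0 : ℤ) < 5 * 2 ^ i * o := by
    have : (0 : ℤ) < o := by exact_mod_cast ho.pos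
    positivity
  have hyp : (0 : ℤ) < 5 * 2 ^ i * o' := by
    have : (0 : ℤ) < o' := by exact_mod_cast ho'.pos
    positivity
  have hz0 : z ≠ 0 := by
    have := ho.pos
    omega
  obtain ⟨w, c, hc, hw, hwc⟩ := exists_five_mul_two_pow_mul_odd (n := n) (z := 5 * 2 ^ i * z)
    (by positivity) ⟨2 ^ i * z, by ring⟩ (by
      rcases hsz with ⟨h, -⟩ | ⟨-, h⟩ <;> rw [← h, abs_lt] <;> constructor <;> linarith)
  have hiw : i + 2 ≤ w := by
    by_contra! hlt
    obtain ⟨t, rfl⟩ : ∃ t, z = 4 * t := ⟨z / 4, by omega⟩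
    obtain ⟨r, hr⟩ := Nat.exists_eq_add_of_lt hlt
    have h1 : (2 : ℤ) ^ w * (2 * (2 ^ r * t)) = 2 ^ w * c := by
      have h2 : (2 : ℤ) ^ i * 4 = 2 ^ w * (2 * 2 ^ r) := by
        rw [show (4 : ℤ) = 2 ^ 2 by norm_num, ← pow_add, hr]; ring
      have h5 : (5 : ℤ) * (2 ^ w * (2 * (2 ^ r * t))) = 5 * (2 ^ w * c) := by
        linear_combination hwc - 5 * t * h2
      exact mul_left_cancel₀ (by norm_num) h5
    have h3 := mul_left_cancel₀ (by positivity) h1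
    rw [← h3] at hc
    exact (Int.not_even_iff_odd.2 hc) ⟨_, two_mul _⟩
  obtain ⟨t, ht⟩ : ∃ t, s = 2 * t := ⟨s / 2, by omega⟩
  have ht' : Odd t := by rw [Int.odd_iff]; omega
  obtain ⟨hm, hbal⟩ := Kpair_iterate_merge (m := n - w) (w := w) (s := 5 * 2 ^ i * s)
    (z := 5 * 2 ^ i * z) hx hy
    (by push_cast; rw [← mul_sub, ← mul_add]
        rcases hsz with ⟨h1, h2⟩ | ⟨h1, h2⟩
        · exact Or.inl ⟨by rw [h1], by rw [h2]⟩
        · exact Or.inr ⟨by rw [h1], by rw [h2]⟩) (by omega) hwc hc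
    (not_dvd_of_eq_two_pow_mul (c := 5 * o) (w := i) (Odd.mul (by decide) hoz)
      (by push_cast; ring) (by omega))
    (not_dvd_of_eq_two_pow_mul (c := 5 * o') (w := i) (Odd.mul (by decide) hoz')
      (by push_cast; ring) (by omega))
    (not_dvd_of_eq_two_pow_mul (c := 5 * t) (w := i + 1) (Odd.mul (by decide) ht')
      (by rw [ht]; ring) (by omega))
  obtain ⟨o₁, ho₁, hx₁⟩ :=
    tent_iterate_five_mul_odd (n := n) (i := i) (m := n - w) ho (by omega)
  obtain ⟨o₂, ho₂, hy₂⟩ :=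
    tent_iterate_five_mul_odd (n := n) (i := i) (m := n - w) ho' (by omega)
  have hyle := tent_iterate_le hy.le (n - w)
  have hxle := tent_iterate_le hx.le (n - w)
  have hlt : ∀ o₃, Odd o₃ → 5 * 2 ^ (i + (n - w)) * o₃ ≤ 5 * 2 ^ n →
      5 * 2 ^ (i + (n - w)) * o₃ < 5 * 2 ^ n := by
    intro o₃ ho₃ hle
    refine lt_of_le_of_ne hle fun h => ?_
    have h1 : 2 ^ (i + (n - w)) * o₃ = 2 ^ (i + (n - w)) * (2 ^ (w - i)) := by
      rw [← pow_add, show i + (n - w) + (w - i) = n by omega]; nlinarith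
    have h2 := Nat.eq_of_mul_eq_mul_left (by positivity) h1
    rw [h2] at ho₃
    exact (Nat.not_even_iff_odd.2 ho₃) ((Nat.even_pow' (by omega)).2 even_two)
  rw [hx₁] at hm hbal hxle
  rw [hy₂] at hm hbal hyle
  exact Kpair_iterate_eq_of_add_le hm (balanced_five_dvd_le (j := w - i) ho₁ (by omega)
    (by omega) (hlt _ ho₁ hxle) (hlt _ ho₂ hyle) hbal (hbas.iterate hm)) (by omega)

theorem five_dvd_le {x y : ℕ} (hx : x < 5 * 2 ^ n) (hy : y < 5 * 2 ^ n) (hx0 : 0 < x)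
    (hy0 : 0 < y) (hne : x ≠ y) (hx5 : x % 5 = 0) (hy5 : y % 5 = 0)
    (hbas : InBasin n (sort2 (x, y))) :
    (Kpair (5 * 2 ^ n))^[maxDepth n] (sort2 (x, y)) = (3 * 2 ^ n, 2 ^ n) := by
  have h1 := singleBound_add_le n
  have h2 := balancedBound_add_le n
  obtain ⟨i, j, o, ho, hij, hj, rfl⟩ := exists_odd_part hx5 hx0 hx
  obtain ⟨i', j', o', ho', hij', hj', rfl⟩ := exists_odd_part hy5 hy0 hy
  rcases lt_trichotomy i i' with h | rfl | h
  · rw [sort2_comm] at hbas ⊢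
    exact Kpair_iterate_eq_of_le (five_dvd_of_lt_le ho' ho hij' h hj' hy hx hbas) (by omega)
  · exact Kpair_iterate_eq_of_le (five_dvd_of_eq_le ho ho' (by rintro rfl; exact hne rfl)
      hx hy hbas) (by omega)
  · exact Kpair_iterate_eq_of_le (five_dvd_of_lt_le ho ho' hij h hj hx hy hbas) (by omega)

theorem Kpair_iterate_maxDepth {x y : ℕ} (hn : 1 ≤ n) (hx : x < 5 * 2 ^ n) (hy : y < 5 * 2 ^ n)
    (hbas : InBasin n (sort2 (x, y))) :
    (Kpair (5 * 2 ^ n))^[maxDepth n] (sort2 (x, y)) = (3 * 2 ^ n, 2 ^ n) := by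
  have h1 := singleBound_add_le n
  have h2 := balancedBound_add_le n
  rcases Nat.eq_zero_or_pos y with rfl | hy0
  · rcases Nat.eq_zero_or_pos x with rfl | hx0
    · refine absurd hbas (not_inBasin_of_periodic (m := 1) le_rfl ?_ (sort2_zero_ne _))
      simp [Kpair, sort2]
    · exact Kpair_iterate_eq_of_le (single_le hn hx0 hx hbas) (by omega)
  rcases Nat.eq_zero_or_pos x with rfl | hx0
  · rw [sort2_comm] at hbas ⊢
    exact Kpair_iterate_eq_of_le (single_le hn hy0 hy hbas) (by omega)
  by_cases hb : x = y ∨ x + y = 5 * 2 ^ n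
  · by_cases h5 : x % 5 = 0
    · obtain ⟨i, j, o, ho, hij, hj, rfl⟩ := exists_odd_part h5 hx0 hx
      exact Kpair_iterate_eq_of_le (balanced_five_dvd_le ho hij hj hx hy hb hbas) (by omega)
    · exact Kpair_iterate_eq_of_le (balanced_le hn hx hy hb h5 hbas) (by omega)
  by_cases hx5 : x % 5 = 0
  · by_cases hy5 : y % 5 = 0
    · exact five_dvd_le hx hy hx0 hy0 (by omega) hx5 hy5 hbas
    · exact Kpair_iterate_eq_of_le (five_dvd_left_le hn hx hy hx0 hx5 hy5 hbas) (by omega)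
  by_cases hy5 : y % 5 = 0
  · rw [sort2_comm] at hbas ⊢
    exact Kpair_iterate_eq_of_le (five_dvd_left_le hn hy hx hy0 hy5 hx5 hbas) (by omega)
  by_cases hc : x % 5 = y % 5 ∨ (x + y) % 5 = 0
  · exact Kpair_iterate_eq_of_le (congruent_le hn hx hy (by omega) hx5 hc hbas) (by omega)
  · exact Kpair_iterate_eq_of_le (Kpair_iterate_eq_fixed hx hy (by omega)) (by omega)

end UpperBound

section LowerBound

variable {n : ℕ}

/-- The number of steps from `q` to the fixed pair is exactly `k + 1`. -/
def ExactDepth (n k : ℕ) (q : ℕ × ℕ) : Prop :=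
  (Kpair (5 * 2 ^ n))^[k + 1] q = (3 * 2 ^ n, 2 ^ n) ∧
    (Kpair (5 * 2 ^ n))^[k] q ≠ (3 * 2 ^ n, 2 ^ n)

theorem ExactDepth.of_iterate {p q : ℕ × ℕ} {a k m : ℕ} (h : ExactDepth n k q)
    (hpq : (Kpair (5 * 2 ^ n))^[a] p = q) (hm : m = k + a) : ExactDepth n m p := by
  subst hm
  refine ⟨?_, ?_⟩
  · rw [show k + a + 1 = k + 1 + a by omega, Function.iterate_add_apply, hpq]; exact h.1
  · rw [Function.iterate_add_apply, hpq]; exact h.2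

theorem Kpair_iterate_five {m : ℕ} (hm : 1 ≤ m) (hmn : m < n) :
    (Kpair (5 * 2 ^ n))^[n + 1] (sort2 (5 * 2 ^ m, 5)) = sort2 (2 ^ m, 0) := by
  have hpm : 0 < 2 ^ m := by positivity
  have hlt : 2 ^ m < 2 ^ n := Nat.pow_lt_pow_right (by norm_num) hmn
  have hx' : (tent (5 * 2 ^ n))^[n - m] (5 * 2 ^ m) = 0 := by
    have h := tent_iterate_eq_zero (n := n) (i := m) (j := n - m) odd_one (by omega) (by omega)
      (by omega)
    rwa [mul_one] at h
  obtain ⟨o, ho, hy'⟩ :=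
    tent_iterate_five_mul_odd (n := n) (i := 0) (m := n - m) odd_one (by omega)
  rw [pow_zero, mul_one, mul_one, zero_add] at hy'
  have hyle := tent_iterate_le (b := 5 * 2 ^ n) (d := 5) (by omega) (n - m)
  have hpos : 0 < 5 * 2 ^ (n - m) * o := Nat.mul_pos (by positivity) ho.pos
  have hyb : 5 * 2 ^ (n - m) * o ≠ 5 * 2 ^ n := by
    intro h
    have h1 : 2 ^ (n - m) * o = 2 ^ (n - m) * (2 ^ m) := by
      rw [← pow_add, show n - m + m = n by omega]; nlinarith
    have h2 := Nat.eq_of_mul_eq_mul_left (by positivity) h1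
    rw [h2] at ho
    exact (Nat.not_even_iff_odd.2 ho) ((Nat.even_pow' (by omega)).2 even_two)
  rw [hy'] at hyle
  have h := Kpair_iterate_of_tent_ne (b := 5 * 2 ^ n) (x := 5 * 2 ^ m) (y := 5) (n - m)
    (by omega) (by omega) (by omega)
  rw [hx', hy', sort2_comm 0] at h
  rw [show n + 1 = m + 1 + (n - m) by omega, Function.iterate_add_apply, h]
  exact Kpair_iterate_single_zero ho (by omega) hm (by omega)

theorem exists_exactDepth_of_mod_zero (hn : 4 ≤ n) (h4 : n % 4 = 0) :
    ∃ x y, x < 5 * 2 ^ n ∧ y < 5 * 2 ^ n ∧ ExactDepth n (4 * n + 4) (sort2 (x, y)) := by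
  have hlt : 2 ^ 3 < 2 ^ n := Nat.pow_lt_pow_right (by norm_num) (by omega)
  refine ⟨5 * 2 ^ 3, 5, by omega, by omega, ?_⟩
  have h1 := Kpair_iterate_five (n := n) (m := 3) (by norm_num) (by omega)
  obtain ⟨e, e', h2, he, he', hb, h5, -⟩ := Kpair_iterate_single_of_three (n := n)
    (x := 2 ^ 3) (by omega) (by omega) (by norm_num)
  have h3 := Kpair_iterate_balanced_two he he' hb (by omega) (h5 (by rw [Nat.even_iff]; omega))
  have h6 : ExactDepth n (n + 1) (sort2 (2 ^ (n + 1), 0)) :=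
    Kpair_iterate_single_of_two_or_four (by rw [pow_succ]; omega) (by omega)
      (Or.inl ((two_pow_mod_five (n + 1)).2.1 (by omega)))
  exact ((h6.of_iterate h3 rfl).of_iterate h2 rfl).of_iterate h1 (by omega)

theorem exists_exactDepth_of_mod_one (hn : 4 ≤ n) (h4 : n % 4 = 1) :
    ∃ x y, x < 5 * 2 ^ n ∧ y < 5 * 2 ^ n ∧ ExactDepth n (3 * n + 3) (sort2 (x, y)) := by
  have hlt : 2 ^ 3 < 2 ^ n := Nat.pow_lt_pow_right (by norm_num) (by omega)
  refine ⟨5 * 2 ^ 3, 5, by omega, by omega, ?_⟩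
  have h1 := Kpair_iterate_five (n := n) (m := 3) (by norm_num) (by omega)
  obtain ⟨e, e', h2, he, he', hb, -, h5⟩ := Kpair_iterate_single_of_three (n := n)
    (x := 2 ^ 3) (by omega) (by omega) (by norm_num)
  have h3 : ExactDepth n (n + 1) (sort2 (e, e')) :=
    Kpair_iterate_balanced_one he he' hb (by omega) (h5 (by rw [Nat.odd_iff]; omega))
  exact (h3.of_iterate h2 rfl).of_iterate h1 (by omega)

theorem exists_exactDepth_of_mod_two (hn : 5 ≤ n) (h4 : n % 4 = 2) :
    ∃ x y, x < 5 * 2 ^ n ∧ y < 5 * 2 ^ n ∧ ExactDepth n (3 * n + 3) (sort2 (x, y)) := by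
  have hlt : 2 ^ 4 < 2 ^ n := Nat.pow_lt_pow_right (by norm_num) (by omega)
  refine ⟨5 * 2 ^ 4, 5, by omega, by omega, ?_⟩
  have h1 := Kpair_iterate_five (n := n) (m := 4) (by norm_num) (by omega)
  have h2 := Kpair_iterate_single_even (n := n) (x := 2 ^ 4) (by omega) (by omega) (by decide)
    (by norm_num)
  have h3 : ExactDepth n (n + 1) (sort2 (2 ^ n, 0)) :=
    Kpair_iterate_single_of_two_or_four (by omega) (by omega)
      (Or.inr ((two_pow_mod_five n).2.2.1 h4))
  exact (h3.of_iterate h2 rfl).of_iterate h1 (by omega)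

theorem exists_exactDepth_of_mod_three (h4 : n % 4 = 3) :
    ∃ x y, x < 5 * 2 ^ n ∧ y < 5 * 2 ^ n ∧ ExactDepth n (5 * n + 4) (sort2 (x, y)) := by
  have hlt : 2 ^ 2 < 2 ^ n := Nat.pow_lt_pow_right (by norm_num) (by omega)
  refine ⟨4, 1, by omega, by omega, ?_⟩
  have hodd : Odd n := by rw [Nat.odd_iff]; omega
  obtain ⟨h1, hb⟩ := Kpair_iterate_merge (n := n) (x := 4) (y := 1) (m := n) (w := 0) (s := 3)
    (z := 5) (c := 1) (by omega) (by omega) (Or.inr ⟨by norm_num, by norm_num⟩) (by omega)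
    (by norm_num) odd_one (not_dvd_of_not_five_dvd (by norm_num) _)
    (not_dvd_of_not_five_dvd (by norm_num) _) (not_dvd_of_not_five_dvd (by norm_num) _)
  have he5 := (tent_iterate_mod_five_of_odd (n := n) hodd 4).1 (Or.inr rfl)
  have he5' := (tent_iterate_mod_five_of_odd (n := n) hodd 1).1 (Or.inl rfl)
  have hele := tent_iterate_le (b := 5 * 2 ^ n) (d := 4) (by omega) n
  have hele' := tent_iterate_le (b := 5 * 2 ^ n) (d := 1) (by omega) n
  have h2 := Kpair_iterate_balanced_two (by omega) (by omega) hb (by omega) he5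
  have h3 := Kpair_iterate_single_even (n := n) (x := 2 ^ (n + 1)) (by rw [pow_succ]; omega)
    (by omega) ((Nat.even_pow' (by omega)).2 even_two) ((two_pow_mod_five (n + 1)).1 (by omega))
  obtain ⟨e, e', h6, he, he', hb', -, h5⟩ := Kpair_iterate_single_of_three (n := n)
    (x := 2 ^ n) (by omega) (by omega) ((two_pow_mod_five n).2.2.2 h4)
  have h7 : ExactDepth n (n + 1) (sort2 (e, e')) :=
    Kpair_iterate_balanced_one he he' hb' (by omega) (h5 hodd)
  exact (((h7.of_iterate h6 rfl).of_iterate h3 rfl).of_iterate h2 rfl).of_iterate h1 (by omega)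

theorem exists_exactDepth (hn : 3 ≤ n) :
    ∃ x y, x < 5 * 2 ^ n ∧ y < 5 * 2 ^ n ∧ ExactDepth n (maxDepth n - 1) (sort2 (x, y)) := by
  have hcases : n % 4 = 0 ∨ n % 4 = 1 ∨ n % 4 = 2 ∨ n % 4 = 3 := by omega
  unfold maxDepth
  rcases hcases with hc | hc | hc | hc
  · simpa [hc] using exists_exactDepth_of_mod_zero (by omega) hc
  · simpa [hc] using exists_exactDepth_of_mod_one (by omega) hc
  · simpa [hc] using exists_exactDepth_of_mod_two (by omega) hc
  · simpa [hc] using exists_exactDepth_of_mod_three hc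

end LowerBound

section Kaprekar

variable {n : ℕ}

theorem IsDiffPair.sort2_eq {b : ℕ} {p : ℕ × ℕ} (hp : IsDiffPair b p) : sort2 p = p := by
  simp only [sort2, max_eq_left hp.1, min_eq_right hp.1]

theorem isDiffPair_sort2 {b x y : ℕ} (hx : x < b) (hy : y < b) : IsDiffPair b (sort2 (x, y)) := by
  simp only [IsDiffPair, sort2]; omega

theorem eq_of_Kpair_eq_self (hn : 1 ≤ n) {p : ℕ × ℕ} (hp : IsDiffPair (5 * 2 ^ n) p)
    (h0 : p ≠ (0, 0)) (h : Kpair (5 * 2 ^ n) p = p) : p = (3 * 2 ^ n, 2 ^ n) := by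
  have hN : 0 < 2 ^ n := by positivity
  have hev : 2 ^ n % 2 = 0 := Nat.even_iff.1 ((Nat.even_pow' (by omega)).2 even_two)
  obtain ⟨x, y⟩ := p
  obtain ⟨h1, h2⟩ := hp
  simp only [Kpair, sort2, ne_eq, Prod.mk.injEq] at *
  generalize 2 ^ n = N at *
  split_ifs at h <;> simp only [Prod.mk.injEq] at h <;> omega

theorem pairValue_fixed_ne_zero (n : ℕ) : pairValue (5 * 2 ^ n) (3 * 2 ^ n, 2 ^ n) ≠ 0 := by
  have hN : 0 < 2 ^ n := by positivity
  have h : 1 < (5 * 2 ^ n) ^ 3 := Nat.one_lt_pow (by norm_num) (by omega)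
  have h' : 0 < 3 * 2 ^ n * ((5 * 2 ^ n) ^ 3 - 1) := Nat.mul_pos (by omega) (by omega)
  simp only [pairValue]
  omega

theorem two_le_base (n : ℕ) : 2 ≤ 5 * 2 ^ n := by
  have hN : 0 < 2 ^ n := by positivity
  omega

theorem inBasin_of_mem_KapSet (hn : 1 ≤ n) {x : ℕ} (hx : x ∈ KapSet (5 * 2 ^ n)) :
    InBasin n (diffPair (5 * 2 ^ n) x) := by
  have hb := two_le_base n
  obtain ⟨-, t, ht, h0⟩ := hx
  refine ⟨t, ?_⟩
  have h1 := ht (t + 1) (by omega)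
  have h2 := Kap_iterate_succ hb x t
  rw [← diffPair_Kap_iterate hb] at h2 ⊢
  refine eq_of_Kpair_eq_self hn (isDiffPair_diffPair (by omega) _) ?_ ?_
  · intro h3
    rw [h1, h3] at h2
    exact h0 (by simpa [pairValue] using h2)
  · rw [← diffPair_Kap hb, ← Function.iterate_succ_apply' (Kap _), h1]

theorem Kap_iterate_of_mem_KapSet (hn : 1 ≤ n) {x : ℕ} (hx : x ∈ KapSet (5 * 2 ^ n)) :
    (Kap (5 * 2 ^ n))^[maxDepth n + 1] x = (Kap (5 * 2 ^ n))^[maxDepth n + 1 + 1] x := by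
  have hb := two_le_base n
  have hp := isDiffPair_diffPair (b := 5 * 2 ^ n) (by omega) x
  have hbas := inBasin_of_mem_KapSet hn hx
  have h : (Kpair (5 * 2 ^ n))^[maxDepth n] (diffPair (5 * 2 ^ n) x) = (3 * 2 ^ n, 2 ^ n) := by
    generalize diffPair (5 * 2 ^ n) x = p at *
    rw [← hp.sort2_eq] at hbas ⊢
    obtain ⟨h1, h2⟩ := hp
    exact Kpair_iterate_maxDepth hn (by omega) (by omega) hbas
  rw [Kap_iterate_succ hb, Kap_iterate_succ hb, h, Kpair_iterate_eq_of_le h (Nat.le_succ _)]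

theorem exists_mem_KapSet_of_exactDepth {p : ℕ × ℕ} {m : ℕ} (hp : IsDiffPair (5 * 2 ^ n) p)
    (h : ExactDepth n m p) : ∃ x ∈ KapSet (5 * 2 ^ n), ∀ k,
      (Kap (5 * 2 ^ n))^[k] x = (Kap (5 * 2 ^ n))^[k + 1] x → m + 1 < k := by
  have hb := two_le_base n
  have hdp := diffPair_digits_zero_zero hp (by omega)
  obtain ⟨hp1, hp2⟩ := hp
  set b := 5 * 2 ^ n with hbdef
  have hval : ∀ s, m + 1 ≤ s → (Kap b)^[s + 1] (p.1 * b ^ 3 + p.2 * b ^ 2) =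
      pairValue b (3 * 2 ^ n, 2 ^ n) := by
    intro s hs
    rw [Kap_iterate_succ hb, hdp, Kpair_iterate_eq_of_le h.1 hs]
  refine ⟨p.1 * b ^ 3 + p.2 * b ^ 2, ⟨?_, m + 2, fun s hs => ?_, ?_⟩, fun k hk => ?_⟩
  · have h1 : p.1 + 1 ≤ b := by omega
    have h2 : p.2 < b := by omega
    calc p.1 * b ^ 3 + p.2 * b ^ 2 < p.1 * b ^ 3 + b * b ^ 2 := by
          have := Nat.mul_lt_mul_of_pos_right h2 (show 0 < b ^ 2 by positivity)
          omega
      _ = (p.1 + 1) * b ^ 3 := by ring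
      _ ≤ b * b ^ 3 := Nat.mul_le_mul_right _ h1
      _ = b ^ 4 := by ring
  · obtain ⟨r, rfl⟩ := Nat.exists_eq_add_of_le' (show 1 ≤ s by omega)
    rw [hval r (by omega), hval (m + 1) le_rfl]
  · rw [hval (m + 1) le_rfl]
    exact pairValue_fixed_ne_zero n
  · by_contra! hle
    obtain ⟨c, hc⟩ := Nat.exists_eq_add_of_le' hle
    have h1 := congrArg (Kap b)^[c] hk
    rw [← Function.iterate_add_apply, ← Function.iterate_add_apply, ← hc, ← add_assoc, ← hc,
      hval (m + 1) le_rfl, Kap_iterate_succ hb, hdp] at h1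
    have h2 := h.1
    refine h.2 (pairValue_injOn ?_ ?_ hb h1)
    · rw [← hdp, ← diffPair_Kap_iterate hb]
      exact isDiffPair_diffPair (by omega) _
    · rw [← h2, ← hdp, ← diffPair_Kap_iterate hb]
      exact isDiffPair_diffPair (by omega) _

end Kaprekar

/-- if `b = 5·2^n` with `n ≥ 3`, then `M_b` is `4n+6`, `3n+5`,
`3n+5`, `5n+6` according as `n ≡ 0, 1, 2, 3 (mod 4)`. -/
theorem kaprekar_M_regular (n b : ℕ) (hn : 3 ≤ n) (hb : b = 5 * 2 ^ n) :
    IsLeast {k : ℕ | ∀ x ∈ KapSet b, (Kap b)^[k] x = (Kap b)^[k + 1] x}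
      (if n % 4 = 0 then 4 * n + 6
       else if n % 4 = 1 then 3 * n + 5
       else if n % 4 = 2 then 3 * n + 5
       else 5 * n + 6) := by
  subst hb
  have hval : (if n % 4 = 0 then 4 * n + 6 else if n % 4 = 1 then 3 * n + 5
      else if n % 4 = 2 then 3 * n + 5 else 5 * n + 6) = maxDepth n + 1 := by
    unfold maxDepth; split_ifs <;> omega
  rw [hval]
  refine ⟨fun x hx => Kap_iterate_of_mem_KapSet (by omega) hx, fun k hk => ?_⟩
  obtain ⟨x, y, hx, hy, h⟩ := exists_exactDepth hn
  obtain ⟨z, hz, hlt⟩ := exists_mem_KapSet_of_exactDepth (isDiffPair_sort2 hx hy) h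
  have := hlt k (hk z hz)
  omega
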